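/- arXiv:math/0009181 — 6 statements merged into one kernel-verified Lean document; each statement's English description precedes it below -/
import Mathlib

section
/- A polynomial p ∈ P is fixed by every pair (u,v) of unipotent upper-triangular matrices acting as described if and only if p lies in the ℂ-subalgebra generated by the principal minors Δ_1, …, Δ_r; that is, the subalgebra of N_k × N_n–invariants of P equals Algebra.adjoin ℂ {Δ_1, …, Δ_r}. -/
open MvPolynomial

namespace Matrix

variable {R : Type*} [CommRing R] {k n : ℕ}

/-- The leading principal `l × l` minor of a `k × n` matrix. -/
def leadingMinor {l : ℕ} (hk : l ≤ k) (hn : l ≤ n) (x : Matrix (Fin k) (Fin n) R) : R :=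
  (x.submatrix (Fin.castLE hk) (Fin.castLE hn)).det

/-- A square matrix is upper unitriangular if it is upper triangular with ones on the diagonal. -/
def IsUpperUnitriangular (u : Matrix (Fin n) (Fin n) R) : Prop :=
  (∀ a, u a a = 1) ∧ ∀ a b, b < a → u a b = 0

lemma submatrix_mul_castLE {l : ℕ} {ι κ : Type*} (hn : l ≤ n) (f : κ → ι)
    (y : Matrix ι (Fin n) R) {v : Matrix (Fin n) (Fin n) R} (hv : ∀ a b, b < a → v a b = 0) :
    (y * v).submatrix f (Fin.castLE hn) =
      y.submatrix f (Fin.castLE hn) * v.submatrix (Fin.castLE hn) (Fin.castLE hn) := by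
  ext i j
  simp only [submatrix_apply, mul_apply]
  symm
  refine Fintype.sum_of_injective (Fin.castLE hn) (Fin.castLE_injective hn) _ _ ?_ fun _ => rfl
  intro b hb
  rw [hv, mul_zero]
  rw [Fin.lt_def, Fin.val_castLE]
  by_contra h
  exact hb ⟨⟨b, by omega⟩, rfl⟩

lemma IsUpperUnitriangular.det_submatrix {l : ℕ} (hn : l ≤ n) {v : Matrix (Fin n) (Fin n) R}
    (hv : v.IsUpperUnitriangular) :
    (v.submatrix (Fin.castLE hn) (Fin.castLE hn)).det = 1 := by
  rw [det_of_isUpperTriangular]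
  · simp [hv.1]
  · exact fun i j hij => hv.2 _ _ hij

lemma leadingMinor_mul {l : ℕ} (hk : l ≤ k) (hn : l ≤ n) (x : Matrix (Fin k) (Fin n) R)
    {v : Matrix (Fin n) (Fin n) R} (hv : v.IsUpperUnitriangular) :
    leadingMinor hk hn (x * v) = leadingMinor hk hn x := by
  rw [leadingMinor, submatrix_mul_castLE hn _ _ hv.2, det_mul, hv.det_submatrix, mul_one,
    leadingMinor]

lemma leadingMinor_transpose {l : ℕ} (hk : l ≤ k) (hn : l ≤ n) (x : Matrix (Fin k) (Fin n) R) :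
    leadingMinor hn hk xᵀ = leadingMinor hk hn x := by
  rw [leadingMinor, ← transpose_submatrix, det_transpose, leadingMinor]

lemma leadingMinor_transpose_mul_mul {l : ℕ} (hk : l ≤ k) (hn : l ≤ n)
    (x : Matrix (Fin k) (Fin n) R) {u : Matrix (Fin k) (Fin k) R} {v : Matrix (Fin n) (Fin n) R}
    (hu : u.IsUpperUnitriangular) (hv : v.IsUpperUnitriangular) :
    leadingMinor hk hn (uᵀ * x * v) = leadingMinor hk hn x := by
  rw [leadingMinor_mul hk hn _ hv, ← leadingMinor_transpose, transpose_mul, transpose_transpose,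
    leadingMinor_mul hn hk _ hu, leadingMinor_transpose]

lemma map_leadingMinor {S F : Type*} [CommRing S] [FunLike F R S] [RingHomClass F R S] (f : F)
    {l : ℕ} (hk : l ≤ k) (hn : l ≤ n) (x : Matrix (Fin k) (Fin n) R) :
    f (leadingMinor hk hn x) = leadingMinor hk hn (x.map f) :=
  RingHom.map_det (f : R →+* S) _

/-- If the first `m` rows and columns of `x` vanish off the diagonal, the leading minor of size
`l ≤ m + 1` is the product of the diagonal entries. -/
lemma leadingMinor_eq_prod {l m : ℕ} (hk : l ≤ k) (hn : l ≤ n) (hm : l ≤ m + 1)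
    {x : Matrix (Fin k) (Fin n) R}
    (hx : ∀ i j, i.val ≠ j.val → min i.val j.val < m → x i j = 0) :
    leadingMinor hk hn x = ∏ i : Fin l, x (Fin.castLE hk i) (Fin.castLE hn i) := by
  rw [leadingMinor, det_of_isUpperTriangular]
  · rfl
  · intro i j hij
    change j < i at hij
    rw [Fin.lt_def] at hij
    refine hx _ _ ?_ ?_ <;> simp only [Fin.val_castLE] <;> omega

lemma leadingMinor_succ {m l : ℕ} (hk : l + 1 ≤ k) (hn : l + 1 ≤ n) (hm : l ≤ m)
    {x : Matrix (Fin k) (Fin n) R}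
    (hx : ∀ i j, i.val ≠ j.val → min i.val j.val < m → x i j = 0) :
    leadingMinor hk hn x =
      leadingMinor (Nat.le_of_succ_le hk) (Nat.le_of_succ_le hn) x * x ⟨l, hk⟩ ⟨l, hn⟩ := by
  rw [leadingMinor_eq_prod hk hn (by omega) hx, leadingMinor_eq_prod _ _ (by omega) hx,
    Fin.prod_univ_castSucc]
  rfl

/-- The matrix with first row `t`, with `-1` on the subdiagonal and zeros elsewhere. -/
def companionRow (k n : ℕ) (t : ℕ → R) : Matrix (Fin k) (Fin n) R :=
  of fun i j => if i.val = 0 then t j else if i.val = j + 1 then -1 else 0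

lemma leadingMinor_companionRow {l : ℕ} (hk : l + 1 ≤ k) (hn : l + 1 ≤ n) (t : ℕ → R) :
    leadingMinor hk hn (companionRow k n t) = t l := by
  rw [leadingMinor, det_succ_column _ (Fin.last l), Fin.sum_univ_succ, Finset.sum_eq_zero]
  · have : ((companionRow k n t).submatrix (Fin.castLE hk) (Fin.castLE hn)).submatrix
        (Fin.succAbove 0) (Fin.succAbove (Fin.last l)) = -1 := by
      ext i j
      simp only [companionRow, submatrix_apply, of_apply, Fin.succAbove_zero, Fin.succAbove_last,
        Fin.val_castLE, Fin.val_succ, Fin.val_castSucc, neg_apply, one_apply, Fin.ext_iff]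
      simp [apply_ite (Neg.neg : R → R)]
    rw [this]
    simp only [det_neg, companionRow, submatrix_apply, of_apply, Fin.val_castLE, Fin.val_zero,
      Fin.val_last, if_true, Fintype.card_fin, det_one, mul_one, zero_add, add_zero]
    rw [mul_right_comm, ← mul_pow]
    simp
  · intro i _
    simp [companionRow, i.2.ne]

end Matrix

open Matrix

section Invariants

variable {k n : ℕ} {K : Type*} [Field K]

/-- Clearing one further row and column of `x` by unitriangular operations. -/
lemma exists_clear_row_column {m : ℕ} (hk : m < k) (hn : m < n) {x : Matrix (Fin k) (Fin n) K}
    (hx : ∀ i j, i.val ≠ j.val → min i.val j.val < m → x i j = 0)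
    (hm : x ⟨m, hk⟩ ⟨m, hn⟩ ≠ 0) :
    ∃ (u : Matrix (Fin k) (Fin k) K) (v : Matrix (Fin n) (Fin n) K),
      u.IsUpperUnitriangular ∧ v.IsUpperUnitriangular ∧
      ∀ i j, i.val ≠ j.val → min i.val j.val < m + 1 → (uᵀ * x * v) i j = 0 := by
  set d := x ⟨m, hk⟩ ⟨m, hn⟩ with hd
  set α : Fin k → K := fun i => if m < i then x i ⟨m, hn⟩ / d else 0 with hα
  set β : Fin n → K := fun j => if m < j then x ⟨m, hk⟩ j / d else 0 with hβ
  refine ⟨1 - vecMulVec (Pi.single ⟨m, hk⟩ 1) α, 1 - vecMulVec (Pi.single ⟨m, hn⟩ 1) β,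
    ⟨fun a => ?_, fun a b hab => ?_⟩, ⟨fun a => ?_, fun a b hab => ?_⟩, fun i j hij h => ?_⟩
  · simp only [Matrix.sub_apply, one_apply_eq, vecMulVec_apply, Pi.single_apply, Fin.ext_iff, hα]
    split_ifs <;> first | omega | simp
  · rw [Fin.lt_def] at hab
    simp only [Matrix.sub_apply, one_apply, vecMulVec_apply, Pi.single_apply, Fin.ext_iff, hα]
    split_ifs <;> first | omega | simp
  · simp only [Matrix.sub_apply, one_apply_eq, vecMulVec_apply, Pi.single_apply, Fin.ext_iff, hβ]
    split_ifs <;> first | omega | simp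
  · rw [Fin.lt_def] at hab
    simp only [Matrix.sub_apply, one_apply, vecMulVec_apply, Pi.single_apply, Fin.ext_iff, hβ]
    split_ifs <;> first | omega | simp
  · have key : ((1 - vecMulVec (Pi.single (⟨m, hk⟩ : Fin k) 1) α : Matrix (Fin k) (Fin k) K)ᵀ * x *
        (1 - vecMulVec (Pi.single (⟨m, hn⟩ : Fin n) 1) β : Matrix (Fin n) (Fin n) K)) i j =
        x i j - α i * x ⟨m, hk⟩ j - (x i ⟨m, hn⟩ - α i * d) * β j := by
      simp [transpose_sub, Matrix.sub_mul, Matrix.mul_sub, transpose_vecMulVec, vecMulVec_mul,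
        mul_vecMulVec, vecMulVec_apply, hd]
    rw [key]
    rcases lt_trichotomy i.val m with hi | hi | hi
    · rw [hx i j hij (by omega), hx i ⟨m, hn⟩ hi.ne (by simp; omega)]
      simp [hα, hi.not_gt]
    · obtain rfl : i = ⟨m, hk⟩ := Fin.ext hi
      rcases lt_trichotomy j.val m with hj | hj | hj
      · rw [hx _ j hij (by omega)]
        simp [hα, hβ, hj.not_gt]
      · exact absurd (hi.trans hj.symm) hij
      · simp only [hα, hβ, lt_irrefl, if_false, if_pos hj]
        rw [← hd]
        field_simp
        ring
    · rcases lt_trichotomy j.val m with hj | hj | hj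
      · rw [hx _ j hij (by omega), hx ⟨m, hk⟩ j hj.ne' (by simp; omega)]
        simp [hβ, hj.not_gt]
      · obtain rfl : j = ⟨m, hn⟩ := Fin.ext hj
        simp only [hα, hβ, lt_irrefl, if_false, if_pos hi]
        rw [← hd]
        field_simp
        ring
      · omega

/-- A function invariant under unitriangular row and column operations takes the same value on `x`
and on some matrix with the same leading minors whose first `m` rows and columns are diagonal. -/
lemma exists_diagonal_of_invariant {T : Type*} {f : Matrix (Fin k) (Fin n) K → T}
    (hf : ∀ (x : Matrix (Fin k) (Fin n) K) (u : Matrix (Fin k) (Fin k) K)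
      (v : Matrix (Fin n) (Fin n) K), IsUpperUnitriangular u → IsUpperUnitriangular v →
      f (uᵀ * x * v) = f x)
    {x : Matrix (Fin k) (Fin n) K}
    (hx : ∀ (l : ℕ) (hk : l ≤ k) (hn : l ≤ n), leadingMinor hk hn x ≠ 0) (m : ℕ) :
    ∃ y : Matrix (Fin k) (Fin n) K, f y = f x ∧
      (∀ (l : ℕ) (hk : l ≤ k) (hn : l ≤ n), leadingMinor hk hn y = leadingMinor hk hn x) ∧
      ∀ i j, i.val ≠ j.val → min i.val j.val < m → y i j = 0 := by
  induction m with
  | zero => exact ⟨x, rfl, fun _ _ _ => rfl, fun _ _ _ h => absurd h (Nat.not_lt_zero _)⟩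
  | succ m ih =>
    obtain ⟨y, hfy, hy, hdiag⟩ := ih
    by_cases hm : m < k ∧ m < n
    · obtain ⟨hk, hn⟩ := hm
      have hne : y ⟨m, hk⟩ ⟨m, hn⟩ ≠ 0 := by
        have := leadingMinor_succ hk hn le_rfl hdiag
        rw [hy] at this
        exact right_ne_zero_of_mul (this ▸ hx _ hk hn)
      obtain ⟨u, v, hu, hv, h⟩ := exists_clear_row_column hk hn hdiag hne
      refine ⟨uᵀ * y * v, (hf _ _ _ hu hv).trans hfy, fun l hk hn => ?_, h⟩
      rw [leadingMinor_transpose_mul_mul hk hn y hu hv, hy]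
    · exact ⟨y, hfy, hy, fun i j hij h => hdiag i j hij (by omega)⟩

/-- A function invariant under unitriangular row and column operations depends only on the leading
minors, as long as these do not vanish. -/
lemma eq_of_leadingMinor_eq {T : Type*} {f : Matrix (Fin k) (Fin n) K → T}
    (hf : ∀ (x : Matrix (Fin k) (Fin n) K) (u : Matrix (Fin k) (Fin k) K)
      (v : Matrix (Fin n) (Fin n) K), IsUpperUnitriangular u → IsUpperUnitriangular v →
      f (uᵀ * x * v) = f x)
    {x y : Matrix (Fin k) (Fin n) K}
    (hx : ∀ (l : ℕ) (hk : l ≤ k) (hn : l ≤ n), leadingMinor hk hn x ≠ 0)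
    (hxy : ∀ (l : ℕ) (hk : l ≤ k) (hn : l ≤ n), leadingMinor hk hn y = leadingMinor hk hn x) :
    f y = f x := by
  obtain ⟨x', hfx, hx', dx⟩ := exists_diagonal_of_invariant hf hx k
  obtain ⟨y', hfy, hy', dy⟩ := exists_diagonal_of_invariant hf (x := y)
    (fun l hk hn => by rw [hxy]; exact hx l hk hn) k
  suffices y' = x' by rw [← hfx, ← hfy, this]
  ext i j
  by_cases hij : i.val = j.val
  · obtain ⟨l, hk⟩ := i
    obtain ⟨_, hn⟩ := j
    obtain rfl : l = _ := hij
    have h1 := leadingMinor_succ hk hn (Nat.le_of_lt hk) dx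
    have h2 := leadingMinor_succ hk hn (Nat.le_of_lt hk) dy
    rw [hy', hxy, hy', hxy] at h2
    rw [hx', hx', h2] at h1
    exact mul_left_cancel₀ (hx _ _ _) h1
  · rw [dx i j hij (by omega), dy i j hij (by omega)]

/-- The generic `k × n` matrix. -/
noncomputable def genericMatrix (R : Type*) [CommRing R] (k n : ℕ) :
    Matrix (Fin k) (Fin n) (MvPolynomial (Fin k × Fin n) R) :=
  of fun i j => X (i, j)

lemma aeval_leadingMinor_genericMatrix {R S : Type*} [CommRing R] [CommRing S] [Algebra R S]
    {l : ℕ} (hk : l ≤ k) (hn : l ≤ n) (g : Fin k × Fin n → S) :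
    aeval g (leadingMinor hk hn (genericMatrix R k n)) =
      leadingMinor hk hn (of fun i j => g (i, j)) := by
  rw [map_leadingMinor]
  congr 1
  ext i j
  simp [genericMatrix]

lemma leadingMinor_genericMatrix_ne_zero {R : Type*} [CommRing R] [Nontrivial R]
    {l : ℕ} (hk : l ≤ k) (hn : l ≤ n) : leadingMinor hk hn (genericMatrix R k n) ≠ 0 := by
  intro h
  have := aeval_leadingMinor_genericMatrix (R := R) hk hn
    fun x => if x.1.val = x.2.val then (1 : R) else 0
  rw [h, map_zero, leadingMinor, show submatrix _ _ _ = (1 : Matrix (Fin l) (Fin l) R) by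
    ext i j; simp [one_apply, Fin.ext_iff], det_one] at this
  exact zero_ne_one this

lemma eval_aeval {σ τ R : Type*} [CommSemiring R] (g : τ → R) (F : σ → MvPolynomial τ R)
    (p : MvPolynomial σ R) : eval g (aeval F p) = eval (fun i => eval g (F i)) p := by
  induction p using MvPolynomial.induction_on with
  | C a => simp
  | add p q hp hq => rw [map_add, map_add, map_add, hp, hq]
  | mul_X p i hp => rw [map_mul, map_mul, map_mul, hp, aeval_X, eval_X]

lemma eval_leadingMinor_genericMatrix {R : Type*} [CommRing R] {l : ℕ} (hk : l ≤ k) (hn : l ≤ n)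
    (g : Fin k × Fin n → R) :
    eval g (leadingMinor hk hn (genericMatrix R k n)) =
      leadingMinor hk hn (of fun i j => g (i, j)) := by
  rw [← aeval_leadingMinor_genericMatrix (R := R) hk hn g, aeval_eq_eval]

/-- Polynomials over an infinite field that agree at all points with nonvanishing leading minors
are equal. -/
lemma eq_of_eval_eq_of_leadingMinor_ne_zero [Infinite K] {p q : MvPolynomial (Fin k × Fin n) K}
    (h : ∀ g : Fin k × Fin n → K, (∀ (l : ℕ) (hk : l ≤ k) (hn : l ≤ n),
      leadingMinor hk hn (of fun i j => g (i, j)) ≠ 0) → eval g p = eval g q) :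
    p = q := by
  have hd : ∏ l : {l : Fin (k + 1) // l.val ≤ n},
      leadingMinor (Nat.lt_succ_iff.1 l.1.2) l.2 (genericMatrix K k n) ≠ 0 :=
    Finset.prod_ne_zero_iff.2 fun l _ => leadingMinor_genericMatrix_ne_zero _ _
  refine mul_right_cancel₀ hd (MvPolynomial.funext fun g => ?_)
  rw [map_mul, map_mul, map_prod]
  by_cases hg : ∀ (l : ℕ) (hk : l ≤ k) (hn : l ≤ n),
      leadingMinor hk hn (of fun i j => g (i, j)) ≠ 0
  · rw [h g hg]
  · push Not at hg
    obtain ⟨l, hk, hn, h0⟩ := hg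
    rw [Finset.prod_eq_zero (Finset.mem_univ ⟨⟨l, Nat.lt_succ_iff.2 hk⟩, hn⟩), mul_zero, mul_zero]
    rw [eval_leadingMinor_genericMatrix, h0]

/-- An invariant polynomial equals its composition with a section of the map sending a matrix to
its leading minors. -/
lemma eq_aeval_companionRow [Infinite K] {p : MvPolynomial (Fin k × Fin n) K}
    (hp : ∀ (x : Matrix (Fin k) (Fin n) K) (u : Matrix (Fin k) (Fin k) K)
      (v : Matrix (Fin n) (Fin n) K), IsUpperUnitriangular u → IsUpperUnitriangular v →
      eval (fun z => (uᵀ * x * v) z.1 z.2) p = eval (fun z => x z.1 z.2) p)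
    {t : ℕ → MvPolynomial (Fin k × Fin n) K}
    (ht : ∀ (l : ℕ) (hk : l + 1 ≤ k) (hn : l + 1 ≤ n),
      t l = leadingMinor hk hn (genericMatrix K k n)) :
    aeval (fun z => companionRow k n t z.1 z.2) p = p := by
  refine eq_of_eval_eq_of_leadingMinor_ne_zero fun g hx => ?_
  have hxy : ∀ (l : ℕ) (hk : l ≤ k) (hn : l ≤ n),
      leadingMinor hk hn ((companionRow k n t).map (eval g)) =
        leadingMinor hk hn (of fun i j => g (i, j)) := fun l hk hn => by
    rw [← map_leadingMinor]
    cases l with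
    | zero => rw [leadingMinor, leadingMinor, det_fin_zero, det_fin_zero, map_one]
    | succ l => rw [leadingMinor_companionRow, ht l hk hn, eval_leadingMinor_genericMatrix]
  rw [eval_aeval]
  have key := eq_of_leadingMinor_eq
    (f := fun x : Matrix (Fin k) (Fin n) K => eval (fun z : Fin k × Fin n => x z.1 z.2) p) hp hx hxy
  simpa only [map_apply, of_apply, Prod.mk.eta] using key

end Invariants

/-- A polynomial in the entries of a `k × n` matrix of variables is invariant
under the action `p(x) ↦ p(uᵀ x v)` of all pairs `(u, v)` of unipotent
upper-triangular matrices if and only if it is a polynomial in the principal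
minors `Δ_1, …, Δ_{min(k,n)}`. -/
theorem unipotent_invariants_eq_adjoin_principal_minors
    (k n : ℕ) (hk : 1 ≤ k) (hn : 1 ≤ n) (p : MvPolynomial (Fin k × Fin n) ℂ) :
    (∀ (u : Matrix (Fin k) (Fin k) ℂ) (v : Matrix (Fin n) (Fin n) ℂ),
        (∀ a, u a a = 1) → (∀ a b, b < a → u a b = 0) →
        (∀ a, v a a = 1) → (∀ a b, b < a → v a b = 0) →
        aeval (fun x : Fin k × Fin n =>
          ∑ a : Fin k, ∑ b : Fin n, C (u a x.1 * v b x.2) * X (a, b)) p = p)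
    ↔ p ∈ Algebra.adjoin ℂ
        {Δ : MvPolynomial (Fin k × Fin n) ℂ |
          ∃ (l : ℕ) (_ : 1 ≤ l) (hlk : l ≤ k) (hln : l ≤ n),
            Δ = (Matrix.of fun i j : Fin l =>
              X ((Fin.castLE hlk i, Fin.castLE hln j) : Fin k × Fin n)).det} := by
  set s := {Δ : MvPolynomial (Fin k × Fin n) ℂ |
    ∃ (l : ℕ) (_ : 1 ≤ l) (hlk : l ≤ k) (hln : l ≤ n),
      Δ = (Matrix.of fun i j : Fin l =>
        X ((Fin.castLE hlk i, Fin.castLE hln j) : Fin k × Fin n)).det}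
  have hact : ∀ (u : Matrix (Fin k) (Fin k) ℂ) (v : Matrix (Fin n) (Fin n) ℂ) (i : Fin k)
      (j : Fin n), ∑ a : Fin k, ∑ b : Fin n,
        (C (u a i * v b j) * X (a, b) : MvPolynomial (Fin k × Fin n) ℂ) =
        ((u.map C : Matrix _ _ (MvPolynomial (Fin k × Fin n) ℂ))ᵀ * genericMatrix ℂ k n *
          (v.map C : Matrix _ _ (MvPolynomial (Fin k × Fin n) ℂ))) i j := fun u v i j => by
    simp only [mul_apply, Finset.sum_mul, transpose_apply, map_apply, genericMatrix, of_apply,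
      C_mul]
    rw [Finset.sum_comm]
    exact Finset.sum_congr rfl fun _ _ => Finset.sum_congr rfl fun _ _ => by ring
  constructor
  · intro hp
    set t : ℕ → MvPolynomial (Fin k × Fin n) ℂ := fun l =>
      if h : l + 1 ≤ k ∧ l + 1 ≤ n then leadingMinor h.1 h.2 (genericMatrix ℂ k n) else 0 with ht
    have htmem : ∀ l, t l ∈ Algebra.adjoin ℂ s := fun l => by
      by_cases h : l + 1 ≤ k ∧ l + 1 ≤ n
      · rw [ht]
        simp only [dif_pos h]
        exact Algebra.subset_adjoin ⟨l + 1, by omega, h.1, h.2, rfl⟩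
      · rw [ht]
        simp only [dif_neg h]
        exact zero_mem _
    rw [← eq_aeval_companionRow (p := p) (t := t) (fun x u v hu hv => ?_)
      fun l hk hn => dif_pos ⟨hk, hn⟩]
    · have hmem : ∀ z : Fin k × Fin n, companionRow k n t z.1 z.2 ∈ Algebra.adjoin ℂ s := by
        intro z
        simp only [companionRow, of_apply]
        split_ifs
        exacts [htmem _, neg_mem (one_mem _), zero_mem _]
      have := Subalgebra.mvPolynomial_aeval_coe (Algebra.adjoin ℂ s) (fun z => ⟨_, hmem z⟩) p
      exact this ▸ Subtype.property _
    · conv_rhs => rw [← hp u v hu.1 hu.2 hv.1 hv.2]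
      rw [eval_aeval]
      congr 2
      ext z
      simp only [mul_apply, Finset.sum_mul, transpose_apply, map_sum, map_mul, eval_X, eval_C]
      rw [Finset.sum_comm]
      exact Finset.sum_congr rfl fun _ _ => Finset.sum_congr rfl fun _ _ => by ring
  · intro hp u v hu hu' hv hv'
    have hU : (u.map C : Matrix _ _ (MvPolynomial (Fin k × Fin n) ℂ)).IsUpperUnitriangular :=
      ⟨fun a => by simp [hu], fun a b h => by simp [hu' a b h]⟩
    have hV : (v.map C : Matrix _ _ (MvPolynomial (Fin k × Fin n) ℂ)).IsUpperUnitriangular :=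
      ⟨fun a => by simp [hv], fun a b h => by simp [hv' a b h]⟩
    induction hp using Algebra.adjoin_induction with
    | mem x hx =>
      obtain ⟨l, -, hlk, hln, rfl⟩ := hx
      refine (aeval_leadingMinor_genericMatrix hlk hln _).trans ?_
      simp only [hact]
      exact leadingMinor_transpose_mul_mul hlk hln (genericMatrix ℂ k n) hU hV
    | algebraMap r => simp
    | add x y _ _ hx hy => rw [map_add, hx, hy]
    | mul x y _ _ hx hy => rw [map_mul, hx, hy]
end

section
/- As linear endomorphisms of P one has the identity 2·Ω̃_{ij} = κ_{ij} − Eu_i − Eu_j. -/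
open MvPolynomial

/-- Multiplication by the variable `x_{ac}` as a linear endomorphism of
`ℂ[x_{ij} : i ∈ Fin k, j ∈ Fin n]`. -/
noncomputable def Xop (k n : ℕ) (a : Fin k) (c : Fin n) :
    Module.End ℂ (MvPolynomial (Fin k × Fin n) ℂ) :=
  LinearMap.mulLeft ℂ (X (a, c))

/-- Partial derivative with respect to `x_{ac}` as a linear endomorphism. -/
noncomputable def Dop (k n : ℕ) (a : Fin k) (c : Fin n) :
    Module.End ℂ (MvPolynomial (Fin k × Fin n) ℂ) :=
  (pderiv (a, c)).toLinearMap

/-- The Euler operator `Eu_c = ∑_a x_{ac} ∂_{ac}` of the `c`-th column. -/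
noncomputable def Euler (k n : ℕ) (c : Fin n) :
    Module.End ℂ (MvPolynomial (Fin k × Fin n) ℂ) :=
  ∑ a : Fin k, Xop k n a c * Dop k n a c

theorem Dop_mul_Xop (k n : ℕ) (a b : Fin k) (c d : Fin n) :
    Dop k n a c * Xop k n b d =
      Xop k n b d * Dop k n a c + if a = b ∧ c = d then 1 else 0 := by
  refine LinearMap.ext fun p => ?_
  have hX : pderiv (a, c) (X (b, d) : MvPolynomial (Fin k × Fin n) ℂ) =
      if a = b ∧ c = d then 1 else 0 := by
    rw [pderiv_X, Pi.single_apply]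
    simp only [Prod.mk.injEq, eq_comm]
  simp only [Xop, Dop, Module.End.mul_apply, LinearMap.add_apply, LinearMap.mulLeft_apply,
    Derivation.coeFn_coe, Derivation.leibniz, hX, smul_eq_mul]
  split_ifs <;> simp

theorem Dop_mul_Dop_comm (k n : ℕ) (a b : Fin k) (c d : Fin n) :
    Dop k n a c * Dop k n b d = Dop k n b d * Dop k n a c := by
  refine LinearMap.ext fun p => ?_
  have h : ⁅pderiv (R := ℂ) (a, c), pderiv (R := ℂ) (b, d)⁆ = 0 := by
    refine derivation_ext fun m => ?_
    simp [Derivation.commutator_apply, pderiv_X, Pi.single_apply, apply_ite]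
  have hp := DFunLike.congr_fun h p
  rw [Derivation.commutator_apply, Derivation.zero_apply, sub_eq_zero] at hp
  exact hp

theorem Xop_mul_Xop_comm (k n : ℕ) (a b : Fin k) (c d : Fin n) :
    Xop k n a c * Xop k n b d = Xop k n b d * Xop k n a c :=
  LinearMap.ext fun p => mul_left_comm (X (a, c)) (X (b, d)) p

/-- The summand of `κ_{ij}` is twice that of `Ω̃_{ij}` up to a first-order diagonal term. -/
theorem kappa_summand_eq (k n : ℕ) {i j : Fin n} (hij : i ≠ j) (a b : Fin k) :
    Xop k n a i * Dop k n a j * Xop k n b j * Dop k n b i +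
        Xop k n b j * Dop k n b i * Xop k n a i * Dop k n a j =
      (2 : ℂ) • (Xop k n a i * Dop k n b i * Xop k n b j * Dop k n a j) +
        (if a = b then Xop k n a i * Dop k n a i else 0) +
        (if a = b then Xop k n a j * Dop k n a j else 0) := by
  have h₁ := Dop_mul_Xop k n a b j j
  have h₂ := Dop_mul_Xop k n b a i i
  have h₃ := Dop_mul_Xop k n b b i j
  have h₄ := Dop_mul_Dop_comm k n a b j i
  have h₅ := Xop_mul_Xop_comm k n b a j i
  rw [mul_assoc (Xop k n a i) (Dop k n a j), h₁, mul_assoc (Xop k n b j) (Dop k n b i), h₂,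
    mul_assoc (Xop k n a i) (Dop k n b i), h₃, two_smul]
  rcases eq_or_ne a b with rfl | hab
  · simp only [hij, and_self, and_false, if_true, if_false, mul_add, add_mul, mul_one, add_zero]
    simp only [← mul_assoc, h₅]
    simp only [mul_assoc, h₄]
    abel
  · simp only [hij, hab, hab.symm, false_and, and_false, if_false, add_zero]
    simp only [← mul_assoc, h₅]
    simp only [mul_assoc, h₄]

/-- The identity `2 Ω̃_{ij} = κ_{ij} − Eu_i − Eu_j` of linear endomorphisms of
the polynomial algebra on `k × n` matrices, where
`Ω̃_{ij} = ∑_{a,b} x_{ai} ∂_{bi} x_{bj} ∂_{aj}` and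
`κ_{ij} = ∑_{a,b} (x_{ai} ∂_{aj} x_{bj} ∂_{bi} + x_{bj} ∂_{bi} x_{ai} ∂_{aj})`. -/
theorem two_Omega_eq_kappa_sub_Euler (k n : ℕ) (hk : 1 ≤ k) (hn : 1 ≤ n)
    (i j : Fin n) (hij : i ≠ j) :
    (2 : ℂ) • (∑ a : Fin k, ∑ b : Fin k,
        Xop k n a i * Dop k n b i * Xop k n b j * Dop k n a j) =
      (∑ a : Fin k, ∑ b : Fin k,
        (Xop k n a i * Dop k n a j * Xop k n b j * Dop k n b i +
         Xop k n b j * Dop k n b i * Xop k n a i * Dop k n a j))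
      - Euler k n i - Euler k n j := by
  simp only [kappa_summand_eq k n hij, Finset.sum_add_distrib, ← Finset.smul_sum,
    Finset.sum_ite_eq, Finset.mem_univ, if_true, Euler]
  abel
end

section
/- Let f : U → P^μ be differentiable. Then f satisfies the Knizhnik–Zamolodchikov system — for every z ∈ U and every direction v ∈ ℂ^n, the derivative of f at z in direction v equals 2h·∑_{1≤i<j≤n} ((v_i − v_j)/(z_i − z_j))·Ω_{ij} f(z) — if and only if the function g : U → P^μ defined by g(z) := exp(h·∑_{1≤i<j≤n} (μ_i + μ_j + 2μ_iμ_j/k)·ℓ_{ij}(z))·f(z) satisfies the Casimir system: for every z ∈ U and v ∈ ℂ^n, the derivative of g at z in direction v equals h·∑_{1≤i<j≤n} ((v_i − v_j)/(z_i − z_j))·κ_{ij} g(z). -/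
open MvPolynomial

/-- The operator `Ω̃_{ij} = ∑_{a,b} x_{ai} ∂_{bi} x_{bj} ∂_{aj}`. -/
noncomputable def OmegaTilde (k n : ℕ) (i j : Fin n) :
    Module.End ℂ (MvPolynomial (Fin k × Fin n) ℂ) :=
  ∑ a : Fin k, ∑ b : Fin k, Xop k n a i * Dop k n b i * Xop k n b j * Dop k n a j

/-- The normalized operator `Ω_{ij} = Ω̃_{ij} − (μ_i μ_j/k)·id` acting on the
weight subspace `P^μ`. -/
noncomputable def OmegaOp (k n : ℕ) (μ : Fin n → ℕ) (i j : Fin n) :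
    Module.End ℂ (MvPolynomial (Fin k × Fin n) ℂ) :=
  OmegaTilde k n i j - (((μ i : ℂ) * (μ j : ℂ)) / (k : ℂ)) • 1

/-- The truncated Casimir operator
`κ_{ij} = ∑_{a,b} (x_{ai} ∂_{aj} x_{bj} ∂_{bi} + x_{bj} ∂_{bi} x_{ai} ∂_{aj})`. -/
noncomputable def kappaOp (k n : ℕ) (i j : Fin n) :
    Module.End ℂ (MvPolynomial (Fin k × Fin n) ℂ) :=
  ∑ a : Fin k, ∑ b : Fin k,
    (Xop k n a i * Dop k n a j * Xop k n b j * Dop k n b i +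
     Xop k n b j * Dop k n b i * Xop k n a i * Dop k n a j)

/-- The gauge-transformed function
`g(z) = exp(h ∑_{i<j} (μ_i + μ_j + 2μ_iμ_j/k) ℓ_{ij}(z)) · f(z)`. -/
noncomputable def gaugeFun (k n : ℕ) (h : ℂ) (μ : Fin n → ℕ)
    (ℓ : Fin n → Fin n → (Fin n → ℂ) → ℂ)
    (f : (Fin n → ℂ) → MvPolynomial (Fin k × Fin n) ℂ)
    (z : Fin n → ℂ) : MvPolynomial (Fin k × Fin n) ℂ :=
  Complex.exp (h * ∑ p ∈ Finset.univ.filter (fun p : Fin n × Fin n => p.1 < p.2),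
      ((μ p.1 : ℂ) + (μ p.2 : ℂ) + 2 * (μ p.1 : ℂ) * (μ p.2 : ℂ) / (k : ℂ)) *
        ℓ p.1 p.2 z) • f z

/-- Euler's identity for a polynomial that is homogeneous of degree `m` in the variables of
column `c`. -/
theorem sum_Xop_Dop_apply (k n m : ℕ) (c : Fin n) (p : MvPolynomial (Fin k × Fin n) ℂ)
    (hp : ∀ d ∈ p.support, (∑ a : Fin k, d (a, c)) = m) :
    ∑ a : Fin k, Xop k n a c (Dop k n a c p) = (m : ℂ) • p := by
  have key : ∀ d ∈ p.support,
      ∑ a : Fin k, Xop k n a c (Dop k n a c (monomial d (coeff d p))) =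
        (m : ℂ) • monomial d (coeff d p) := by
    intro d hd
    simp only [Xop, Dop, LinearMap.mulLeft_apply, Derivation.coeFn_coe, X_mul_pderiv_monomial]
    rw [← Finset.sum_smul, hp d hd, Nat.cast_smul_eq_nsmul]
  conv_lhs => rw [p.as_sum]
  conv_rhs => rw [p.as_sum]
  simp only [map_sum, Finset.smul_sum]
  rw [Finset.sum_comm]
  exact Finset.sum_congr rfl key

/-- Partial derivatives of polynomials commute. -/
theorem MvPolynomial.pderiv_pderiv_comm {σ R : Type*} [CommRing R] (s t : σ)
    (q : MvPolynomial σ R) : pderiv s (pderiv t q) = pderiv t (pderiv s q) := by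
  classical
  have h : ⁅(pderiv s : Derivation R (MvPolynomial σ R) (MvPolynomial σ R)),
      (pderiv t : Derivation R (MvPolynomial σ R) (MvPolynomial σ R))⁆ = 0 := by
    apply MvPolynomial.derivation_ext
    intro u
    simp [Derivation.commutator_apply, pderiv_X, Pi.single_apply, apply_ite]
  rw [← sub_eq_zero, ← Derivation.commutator_apply, h, Derivation.zero_apply]

/-- The truncated Casimir operator in terms of `Ω̃_{ij}` and the two Euler operators. -/
theorem kappaOp_apply (k n : ℕ) {i j : Fin n} (hij : i ≠ j)
    (p : MvPolynomial (Fin k × Fin n) ℂ) :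
    kappaOp k n i j p = (2 : ℂ) • OmegaTilde k n i j p +
      ∑ a : Fin k, Xop k n a i (Dop k n a i p) + ∑ a : Fin k, Xop k n a j (Dop k n a j p) := by
  have hterm : ∀ a b : Fin k,
      (Xop k n a i * Dop k n a j * Xop k n b j * Dop k n b i +
        Xop k n b j * Dop k n b i * Xop k n a i * Dop k n a j) p =
      (2 : ℂ) • (Xop k n a i * Dop k n b i * Xop k n b j * Dop k n a j) p +
        (if a = b then Xop k n a i (Dop k n a i p) else 0) +
        (if a = b then Xop k n a j (Dop k n a j p) else 0) := by
    intro a b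
    simp only [Xop, Dop, LinearMap.add_apply, Module.End.mul_apply, LinearMap.mulLeft_apply,
      Derivation.coeFn_coe, Derivation.leibniz, smul_eq_mul, pderiv_X]
    rw [MvPolynomial.pderiv_pderiv_comm (a, j) (b, i), two_smul]
    by_cases hab : a = b
    · subst hab
      simp [hij.symm]
      ring
    · simp [hij.symm, hab, Ne.symm hab]
      ring
  simp only [kappaOp, OmegaTilde, LinearMap.sum_apply, hterm]
  simp only [Finset.sum_add_distrib, Finset.smul_sum, Finset.sum_ite_eq, Finset.mem_univ, if_true]

/-- On polynomials of multidegree `μ`, the operators `κ_{ij}` and `2Ω_{ij}` differ by a scalar. -/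
theorem kappaOp_apply_eq_OmegaOp (k n : ℕ) (μ : Fin n → ℕ) {i j : Fin n} (hij : i ≠ j)
    (p : MvPolynomial (Fin k × Fin n) ℂ)
    (hp : ∀ d ∈ p.support, ∀ c : Fin n, (∑ a : Fin k, d (a, c)) = μ c) :
    kappaOp k n i j p = (2 : ℂ) • OmegaOp k n μ i j p +
      ((μ i : ℂ) + (μ j : ℂ) + 2 * (μ i : ℂ) * (μ j : ℂ) / (k : ℂ)) • p := by
  rw [kappaOp_apply k n hij, sum_Xop_Dop_apply k n (μ i) i p fun d hd => hp d hd i,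
    sum_Xop_Dop_apply k n (μ j) j p fun d hd => hp d hd j]
  simp only [OmegaOp, LinearMap.sub_apply, LinearMap.smul_apply, Module.End.one_apply]
  module

section LineDeriv

variable {E : Type*} [NormedAddCommGroup E] [NormedSpace ℂ E]

/-- A differentiable branch of `log L`, for `L` a continuous linear functional, has logarithmic
line derivative. -/
theorem hasLineDerivAt_of_exp_eq {U : Set E} (hU : IsOpen U) {l : E → ℂ} (L : E →L[ℂ] ℂ)
    (hl : DifferentiableOn ℂ l U) (hexp : ∀ w ∈ U, Complex.exp (l w) = L w) {z : E} (hz : z ∈ U)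
    (v : E) : HasLineDerivAt ℂ l (L v / L z) z v := by
  have hd := (hl.differentiableAt (hU.mem_nhds hz)).hasFDerivAt
  have heq : (fun w => Complex.exp (l w)) =ᶠ[nhds z] L :=
    Filter.eventuallyEq_of_mem (hU.mem_nhds hz) hexp
  have h := hd.cexp.unique (L.hasFDerivAt.congr_of_eventuallyEq heq)
  have hv := congrArg (fun M : E →L[ℂ] ℂ => M v) h
  have h0 : L z ≠ 0 := hexp z hz ▸ Complex.exp_ne_zero _
  have : L v / L z = fderiv ℂ l z v := by
    rw [div_eq_iff h0, ← hexp z hz, ← hv]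
    simp [mul_comm]
  rw [this]
  exact hd.hasLineDerivAt v

theorem HasLineDerivAt.cexp_mul {S F : E → ℂ} {S' F' : ℂ} {z v : E}
    (hS : HasLineDerivAt ℂ S S' z v) (hF : HasLineDerivAt ℂ F F' z v) :
    HasLineDerivAt ℂ (fun w => Complex.exp (S w) * F w)
      (Complex.exp (S z) * (S' * F z + F')) z v := by
  have h := (HasDerivAt.cexp hS).mul hF
  simp only [zero_smul, add_zero] at h
  exact h.congr_deriv (by ring)

theorem hasLineDerivAt_cexp_mul_iff {S F : E → ℂ} {S' F' : ℂ} {z v : E}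
    (hS : HasLineDerivAt ℂ S S' z v) :
    HasLineDerivAt ℂ (fun w => Complex.exp (S w) * F w)
      (Complex.exp (S z) * (S' * F z + F')) z v ↔ HasLineDerivAt ℂ F F' z v := by
  refine ⟨fun hG => ?_, hS.cexp_mul⟩
  have hS_neg : HasLineDerivAt ℂ (fun w => -S w) (-S') z v := HasDerivAt.neg hS
  have hinv : ∀ w x, Complex.exp (-S w) * (Complex.exp (S w) * x) = x := fun w x => by
    rw [← mul_assoc, ← Complex.exp_add, neg_add_cancel, Complex.exp_zero, one_mul]
  have h := hS_neg.cexp_mul hG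
  simp only [hinv] at h
  convert h using 1
  linear_combination (-1 : ℂ) * hinv z F'

end LineDeriv


/-- A differentiable function `f` on an open subset `U` of the configuration
space `X_n`, with values in the weight subspace `P^μ` of polynomials on `k × n`
matrices, satisfies the Knizhnik–Zamolodchikov system
`df = 2h ∑_{i<j} (dz_i − dz_j)/(z_i − z_j) · Ω_{ij} f`
if and only if
`g(z) = exp(h ∑_{i<j} (μ_i + μ_j + 2μ_iμ_j/k) ℓ_{ij}(z)) f(z)`
satisfies the Casimir system
`dg = h ∑_{i<j} (dz_i − dz_j)/(z_i − z_j) · κ_{ij} g`.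
Derivatives are taken coefficientwise: a `P^μ`-valued function has directional
derivative `w` at `z` along `v` iff each coefficient function has the
corresponding line derivative. -/
theorem KZ_iff_Casimir (k n : ℕ) (hk : 1 ≤ k) (hn : 1 ≤ n) (h : ℂ)
    (μ : Fin n → ℕ) (U : Set (Fin n → ℂ)) (hUopen : IsOpen U)
    (hUreg : ∀ z ∈ U, ∀ i j : Fin n, i ≠ j → z i ≠ z j)
    (ℓ : Fin n → Fin n → (Fin n → ℂ) → ℂ)
    (hℓdiff : ∀ i j : Fin n, i < j → DifferentiableOn ℂ (ℓ i j) U)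
    (hℓ : ∀ i j : Fin n, i < j → ∀ z ∈ U, Complex.exp (ℓ i j z) = z i - z j)
    (f : (Fin n → ℂ) → MvPolynomial (Fin k × Fin n) ℂ)
    (hfμ : ∀ z ∈ U, ∀ d ∈ (f z).support, ∀ j : Fin n,
      (∑ a : Fin k, d (a, j)) = μ j)
    (hfdiff : ∀ d : (Fin k × Fin n) →₀ ℕ,
      DifferentiableOn ℂ (fun z => coeff d (f z)) U) :
    (∀ z ∈ U, ∀ v : Fin n → ℂ, ∀ d : (Fin k × Fin n) →₀ ℕ,
      HasLineDerivAt ℂ (fun w => coeff d (f w))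
        (coeff d ((2 * h) •
          ∑ p ∈ Finset.univ.filter (fun p : Fin n × Fin n => p.1 < p.2),
            ((v p.1 - v p.2) / (z p.1 - z p.2)) •
              OmegaOp k n μ p.1 p.2 (f z))) z v)
    ↔
    (∀ z ∈ U, ∀ v : Fin n → ℂ, ∀ d : (Fin k × Fin n) →₀ ℕ,
      HasLineDerivAt ℂ (fun w => coeff d (gaugeFun k n h μ ℓ f w))
        (coeff d (h •
          ∑ p ∈ Finset.univ.filter (fun p : Fin n × Fin n => p.1 < p.2),
            ((v p.1 - v p.2) / (z p.1 - z p.2)) •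
              kappaOp k n p.1 p.2 (gaugeFun k n h μ ℓ f z))) z v) := by
  refine forall₂_congr fun z hz => forall₂_congr fun v d => ?_
  have hS : HasLineDerivAt ℂ
      (fun w => h * ∑ p ∈ Finset.univ.filter (fun p : Fin n × Fin n => p.1 < p.2),
        ((μ p.1 : ℂ) + (μ p.2 : ℂ) + 2 * (μ p.1 : ℂ) * (μ p.2 : ℂ) / (k : ℂ)) * ℓ p.1 p.2 w)
      (h * ∑ p ∈ Finset.univ.filter (fun p : Fin n × Fin n => p.1 < p.2),
        ((μ p.1 : ℂ) + (μ p.2 : ℂ) + 2 * (μ p.1 : ℂ) * (μ p.2 : ℂ) / (k : ℂ)) *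
          ((v p.1 - v p.2) / (z p.1 - z p.2))) z v := by
    refine HasDerivAt.const_mul h (HasDerivAt.fun_sum fun p hp => HasDerivAt.const_mul _ ?_)
    have hlt : p.1 < p.2 := (Finset.mem_filter.mp hp).2
    exact hasLineDerivAt_of_exp_eq hUopen
      (ContinuousLinearMap.proj (R := ℂ) (φ := fun _ : Fin n => ℂ) p.1 -
        ContinuousLinearMap.proj (R := ℂ) (φ := fun _ : Fin n => ℂ) p.2)
      (hℓdiff _ _ hlt) (hℓ _ _ hlt) hz v
  rw [← hasLineDerivAt_cexp_mul_iff hS]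
  simp only [gaugeFun, coeff_smul, smul_eq_mul, map_smul]
  refine iff_of_eq (congrArg (HasLineDerivAt ℂ _ · z v) ?_)
  simp only [coeff_sum, coeff_smul, smul_eq_mul]
  rw [mul_assoc h, mul_comm 2 h, mul_assoc h 2, Finset.mul_sum _ _ (2 : ℂ),
    Finset.sum_mul, ← mul_add, ← Finset.sum_add_distrib, mul_left_comm, Finset.mul_sum]
  congr 1
  refine Finset.sum_congr rfl fun p hp => ?_
  rw [kappaOp_apply_eq_OmegaOp k n μ (Finset.mem_filter.mp hp).2.ne (f z) (hfμ z hz)]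
  simp only [coeff_add, coeff_smul, smul_eq_mul]
  ring
end

section
/- The ordered monomials {X^m : m ∈ (Fin k × Fin n → ℕ)} form an A-module basis of S_q(k,n): they span S_q(k,n) over A and are A-linearly independent (Parshall–Wang basis theorem for quantum matrix space). -/
/-- The defining relations of the algebra of functions on quantum `k × n`
matrix space, as a relation on the free algebra on generators
`X_{ij}`, `i ∈ Fin k`, `j ∈ Fin n`. -/
inductive QMatRel (A : Type*) [CommRing A] (q : Aˣ) (k n : ℕ) :
    FreeAlgebra A (Fin k × Fin n) → FreeAlgebra A (Fin k × Fin n) → Prop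
  | comm (i r : Fin k) (j l : Fin n) (h : (i < r ∧ l < j) ∨ (r < i ∧ j < l)) :
      QMatRel A q k n
        (FreeAlgebra.ι A (i, j) * FreeAlgebra.ι A (r, l))
        (FreeAlgebra.ι A (r, l) * FreeAlgebra.ι A (i, j))
  | qcomm (i r : Fin k) (j l : Fin n) (h : (i < r ∧ j = l) ∨ (i = r ∧ j < l)) :
      QMatRel A q k n
        (FreeAlgebra.ι A (i, j) * FreeAlgebra.ι A (r, l))
        (((q⁻¹ : Aˣ) : A) • (FreeAlgebra.ι A (r, l) * FreeAlgebra.ι A (i, j)))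
  | cross (i r : Fin k) (j l : Fin n) (h : i < r ∧ j < l) :
      QMatRel A q k n
        (FreeAlgebra.ι A (i, j) * FreeAlgebra.ι A (r, l))
        (FreeAlgebra.ι A (r, l) * FreeAlgebra.ι A (i, j) -
          ((q : A) - ((q⁻¹ : Aˣ) : A)) •
            (FreeAlgebra.ι A (r, j) * FreeAlgebra.ι A (i, l)))

/-- The algebra `S_q(k,n)` of functions on quantum `k × n` matrix space. -/
abbrev QMat (A : Type*) [CommRing A] (q : Aˣ) (k n : ℕ) :=
  RingQuot (QMatRel A q k n)

/-- The generator `X_{ij}` of `S_q(k,n)`. -/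
noncomputable def QMat.X (A : Type*) [CommRing A] (q : Aˣ) (k n : ℕ)
    (i : Fin k) (j : Fin n) : QMat A q k n :=
  RingQuot.mkAlgHom A (QMatRel A q k n) (FreeAlgebra.ι A (i, j))

/-- The ordered monomial `X^m = ∏_j ∏_i X_{ij}^{m_{ij}}`, the factors ordered by
increasing column index `j` and, within each column, by increasing row index. -/
noncomputable def QMat.monomial (A : Type*) [CommRing A] (q : Aˣ) (k n : ℕ)
    (m : Fin k × Fin n → ℕ) : QMat A q k n :=
  ((List.finRange n).map fun j =>
    ((List.finRange k).map fun i => QMat.X A q k n i j ^ m (i, j)).prod).prod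

section Straightening

variable {A R : Type*} [CommRing A] [Ring R] [Algebra A R]

theorem Submodule.mul_iSup_pow_le {Y Z : Submodule A R} (h : Z * Y ≤ Y * Z) :
    Z * (⨆ m : ℕ, Y ^ m) ≤ (⨆ m : ℕ, Y ^ m) * Z := by
  rw [Submodule.mul_iSup, Submodule.iSup_mul]
  refine iSup_mono fun m => ?_
  induction m with
  | zero => simp
  | succ m ih =>
    calc Z * Y ^ (m + 1) = Z * Y ^ m * Y := by rw [pow_succ, mul_assoc]
      _ ≤ Y ^ m * Z * Y := mul_le_mul_left ih Y
      _ = Y ^ m * (Z * Y) := mul_assoc _ _ _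
      _ ≤ Y ^ m * (Y * Z) := mul_le_mul_right h _
      _ = Y ^ (m + 1) * Z := by rw [pow_succ, mul_assoc]

theorem Submodule.mul_iSup_pow_self_le (Y : Submodule A R) :
    Y * (⨆ m : ℕ, Y ^ m) ≤ ⨆ m : ℕ, Y ^ m := by
  rw [Submodule.mul_iSup]
  exact iSup_le fun m => (pow_succ' Y m).symm.le.trans (le_iSup (fun m : ℕ => Y ^ m) (m + 1))

theorem Submodule.one_le_iSup_pow (Y : Submodule A R) : 1 ≤ ⨆ m : ℕ, Y ^ m :=
  (pow_zero Y).symm.le.trans (le_iSup (fun m : ℕ => Y ^ m) 0)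

theorem Submodule.mul_list_prod_iSup_pow_le {ι : Type*} (f : ι → Submodule A R) (s : List ι)
    (hs : s.Pairwise fun j l => f l * f j ≤ f j * f l) {l : ι} (hl : l ∈ s) :
    f l * (s.map fun j => ⨆ m : ℕ, f j ^ m).prod ≤ (s.map fun j => ⨆ m : ℕ, f j ^ m).prod := by
  induction s with
  | nil => simp at hl
  | cons a s ih =>
    rw [List.pairwise_cons] at hs
    rw [List.map_cons, List.prod_cons, ← mul_assoc]
    rcases List.mem_cons.1 hl with rfl | hl
    · exact mul_le_mul_left (mul_iSup_pow_self_le _) _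
    · refine (mul_le_mul_left (mul_iSup_pow_le (hs.1 l hl)) _).trans ?_
      rw [mul_assoc]
      exact mul_le_mul_right (ih hs.2 hl) _

theorem Submodule.iSup_pow_iSup_le {n : ℕ} (f : Fin n → Submodule A R)
    (h : ∀ j l, j < l → f l * f j ≤ f j * f l) :
    (⨆ m : ℕ, (⨆ j, f j) ^ m) ≤ ((List.finRange n).map fun j => ⨆ m : ℕ, f j ^ m).prod := by
  refine iSup_le fun m => ?_
  induction m with
  | zero =>
    rw [pow_zero]
    exact List.one_le_prod_of_one_le (by simpa using fun j => one_le_iSup_pow (f j))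
  | succ m ih =>
    rw [pow_succ']
    refine (mul_le_mul_right ih _).trans ?_
    rw [Submodule.iSup_mul]
    exact iSup_le fun j => mul_list_prod_iSup_pow_le f _
      ((List.pairwise_lt_finRange n).imp (h _ _)) (List.mem_finRange j)

theorem Submodule.list_prod_span_range_le {ι κ : Type*} [DecidableEq ι] [Nonempty κ]
    (f : ι → κ → R) (s : List ι) (hs : s.Nodup) :
    (s.map fun i => span A (Set.range (f i))).prod ≤
      span A (Set.range fun g : ι → κ => (s.map fun i => f i (g i)).prod) := by
  induction s with
  | nil => simp [Submodule.one_eq_span]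
  | cons a s ih =>
    rw [List.nodup_cons] at hs
    rw [List.map_cons, List.prod_cons]
    refine (mul_le_mul_right (ih hs.2) _).trans ?_
    rw [Submodule.span_mul_span]
    refine span_mono ?_
    rintro _ ⟨_, ⟨c, rfl⟩, _, ⟨g, rfl⟩, rfl⟩
    refine ⟨Function.update g a c, ?_⟩
    simp only [List.map_cons, List.prod_cons, Function.update_self]
    congr 2
    refine List.map_congr_left fun i hi => ?_
    rw [Function.update_of_ne (by rintro rfl; exact hs.1 hi)]

theorem Submodule.iSup_pow_span_singleton (x : R) :
    (⨆ m : ℕ, span A {x} ^ m) = span A (Set.range fun m : ℕ => x ^ m) := by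
  simp_rw [Submodule.span_pow, Set.singleton_pow, ← Submodule.span_iUnion,
    Set.iUnion_singleton_eq_range]

end Straightening

/-- The relation `R T₁ T₂ = T₂ T₁ R` for a matrix `T` with entries in an `A`-algebra, where `R` is
the R-matrix of type `A` with parameter `q`. It is equivalent to the defining relations of the
quantum matrix algebra. -/
def IsQuantumMatrix {A B ι κ : Type*} [CommRing A] [Ring B] [Algebra A B] [LinearOrder ι]
    [LinearOrder κ] (q : Aˣ) (T : ι → κ → B) : Prop :=
  ∀ i r j l,
    (if i = r then (q : A) else 1) • (T i j * T r l) +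
        (if i < r then (q : A) - ((q⁻¹ : Aˣ) : A) else 0) • (T r j * T i l) =
      (if j = l then (q : A) else 1) • (T r l * T i j) +
        (if l < j then (q : A) - ((q⁻¹ : Aˣ) : A) else 0) • (T r j * T i l)

namespace IsQuantumMatrix

variable {A B C ι κ μ : Type*} [CommRing A] [Ring B] [Algebra A B] [Ring C] [Algebra A C]
  [LinearOrder ι] [LinearOrder κ] [LinearOrder μ] {q : Aˣ}

theorem map {T : ι → κ → B} (hT : IsQuantumMatrix q T) (φ : B →ₐ[A] C) :
    IsQuantumMatrix q fun i j => φ (T i j) := fun i r j l => by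
  simpa only [map_add, map_smul, map_mul] using congrArg φ (hT i r j l)

theorem mul [Fintype κ] {U : ι → κ → B} {V : κ → μ → B} (hU : IsQuantumMatrix q U)
    (hV : IsQuantumMatrix q V) (hUV : ∀ i a b j, Commute (U i a) (V b j)) :
    IsQuantumMatrix q fun i j => ∑ a, U i a * V a j := by
  have key (i r j l) : (∑ a, U i a * V a j) * (∑ b, U r b * V b l) =
      ∑ a, ∑ b, (U i a * U r b) * (V a j * V b l) := by
    rw [Finset.sum_mul_sum]
    refine Finset.sum_congr rfl fun a _ => Finset.sum_congr rfl fun b _ => ?_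
    rw [mul_assoc, ← mul_assoc (V a j), ← (hUV r b a j).eq, mul_assoc, mul_assoc]
  intro i r j l
  simp only [key]
  rw [Finset.sum_comm (f := fun a b => U r a * U i b * (V a l * V b j))]
  calc
    _ = ∑ a, ∑ b, ((if i = r then (q : A) else 1) • (U i a * U r b) +
          (if i < r then (q : A) - ((q⁻¹ : Aˣ) : A) else 0) • (U r a * U i b)) *
            (V a j * V b l) := by
      simp only [add_mul, Finset.sum_add_distrib, Finset.smul_sum, smul_mul_assoc]
    _ = ∑ a, ∑ b, (U r b * U i a) * ((if a = b then (q : A) else 1) • (V a j * V b l)) +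
          ∑ a, ∑ b, (U r a * U i b) *
            ((if b < a then (q : A) - ((q⁻¹ : Aˣ) : A) else 0) • (V a j * V b l)) := by
      simp only [hU i r, add_mul, Finset.sum_add_distrib, smul_mul_assoc, mul_smul_comm]
    _ = ∑ a, ∑ b, (U r b * U i a) * ((if a = b then (q : A) else 1) • (V a j * V b l) +
          (if a < b then (q : A) - ((q⁻¹ : Aˣ) : A) else 0) • (V b j * V a l)) := by
      rw [Finset.sum_comm (f := fun a b => (U r a * U i b) *
        ((if b < a then (q : A) - ((q⁻¹ : Aˣ) : A) else 0) • (V a j * V b l)))]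
      simp only [mul_add, Finset.sum_add_distrib]
    _ = _ := by
      simp only [hV _ _ j l, mul_add, Finset.sum_add_distrib, Finset.smul_sum, mul_smul_comm]
      congr 1
      rw [Finset.sum_comm]

/-- The block diagonal matrix with blocks `1` and `T`. -/
def corner {m n : ℕ} (T : Fin m → Fin n → B) : Fin (m + 1) → Fin (n + 1) → B :=
  Fin.cons (Fin.cons 1 0) fun i => Fin.cons 0 (T i)

theorem isQuantumMatrix_corner {m n : ℕ} {T : Fin m → Fin n → B} (hT : IsQuantumMatrix q T) :
    IsQuantumMatrix q (corner T) := by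
  intro i r j l
  cases i using Fin.cases <;> cases r using Fin.cases <;> cases j using Fin.cases <;>
    cases l using Fin.cases <;>
    simp [corner, (Fin.succ_ne_zero _).symm]
  simpa using hT _ _ _ _

theorem _root_.Fin.casesTwo {n : ℕ} {P : Fin (n + 2) → Prop} (zero : P 0)
    (one : P (Fin.succ 0)) (succ : ∀ i : Fin n, P i.succ.succ) (i : Fin (n + 2)) : P i :=
  Fin.cases zero (Fin.cases one succ) i

/-- The block diagonal matrix with blocks the quantum `2 × 2` matrix `(c, κ; κ, d)` and `1`. -/
def oscillator (n : ℕ) (c κ d : B) : Fin (n + 2) → Fin (n + 2) → B :=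
  Fin.cons (Fin.cons c (Fin.cons κ 0)) <| Fin.cons (Fin.cons κ (Fin.cons d 0)) fun i =>
    Fin.cons 0 (Fin.cons 0 fun j => if i = j then 1 else 0)

theorem isQuantumMatrix_oscillator (n : ℕ) {c κ d : B} (h₁ : κ * c = (q : A) • (c * κ))
    (h₂ : d * κ = (q : A) • (κ * d))
    (h₃ : d * c = c * d + ((q : A) - ((q⁻¹ : Aˣ) : A)) • (κ * κ)) :
    IsQuantumMatrix q (oscillator n c κ d) := by
  have hq : (q : A) * q = 1 + ((q : A) - ((q⁻¹ : Aˣ) : A)) * q := by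
    rw [sub_mul, q.inv_mul]; ring
  intro i r j l
  cases i using Fin.casesTwo <;> cases r using Fin.casesTwo <;> cases j using Fin.casesTwo <;>
    cases l using Fin.casesTwo <;>
    simp [oscillator, h₁, h₂, h₃, (Fin.succ_ne_zero _).symm, -Fin.succ_zero_eq_one,
      -Fin.succ_zero_eq_one']
  case succ.succ.succ.succ => split_ifs <;> grind
  all_goals simp only [smul_smul, hq, add_smul, one_smul]

end IsQuantumMatrix

section Fock

variable {A : Type*} [CommRing A]

/-- The creation operator on the span of the basis vectors `single a 1`, `a : ℕ`. -/
noncomputable def Fock.creation (A : Type*) [CommRing A] : Module.End A (ℕ →₀ A) :=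
  Finsupp.linearCombination A fun a => Finsupp.single (a + 1) 1

/-- The `q`-number operator, which scales `single a 1` by `q ^ a`. -/
noncomputable def Fock.number (q : Aˣ) : Module.End A (ℕ →₀ A) :=
  Finsupp.linearCombination A fun a => Finsupp.single a ((q : A) ^ a)

/-- The annihilation operator which satisfies the `q`-oscillator relation
`d * c = c * d + (q - q⁻¹) • κ ^ 2` with `Fock.creation` and `Fock.number`. -/
noncomputable def Fock.annihilation (q : Aˣ) : Module.End A (ℕ →₀ A) :=
  Finsupp.linearCombination A fun a =>
    Finsupp.single (a - 1) (((q⁻¹ : Aˣ) : A) * ((q : A) ^ (2 * a) - 1))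

@[simp] theorem Fock.creation_single (a : ℕ) (x : A) :
    creation A (Finsupp.single a x) = Finsupp.single (a + 1) x := by
  simp [creation]

@[simp] theorem Fock.number_single (q : Aˣ) (a : ℕ) (x : A) :
    number q (Finsupp.single a x) = Finsupp.single a (x * (q : A) ^ a) := by
  simp [number]

@[simp] theorem Fock.annihilation_single (q : Aˣ) (a : ℕ) (x : A) :
    annihilation q (Finsupp.single a x) =
      Finsupp.single (a - 1) (x * (((q⁻¹ : Aˣ) : A) * ((q : A) ^ (2 * a) - 1))) := by
  simp only [annihilation, Finsupp.linearCombination_single, Finsupp.smul_single, smul_eq_mul]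

theorem Fock.number_mul_creation (q : Aˣ) :
    number q * creation A = (q : A) • (creation A * number q) := by
  refine Finsupp.lhom_ext fun a x => ?_
  simp only [Module.End.mul_apply, LinearMap.smul_apply, creation_single, number_single,
    Finsupp.smul_single, smul_eq_mul]
  congr 1
  ring

theorem Fock.annihilation_mul_number (q : Aˣ) :
    annihilation q * number q = (q : A) • (number q * annihilation q) := by
  refine Finsupp.lhom_ext fun a x => ?_
  simp only [Module.End.mul_apply, LinearMap.smul_apply, annihilation_single, number_single,
    Finsupp.smul_single, smul_eq_mul]
  cases a with
  | zero => simp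
  | succ a =>
    congr 1
    rw [Nat.add_sub_cancel]
    ring

theorem Fock.annihilation_mul_creation (q : Aˣ) :
    annihilation q * creation A =
      creation A * annihilation q + ((q : A) - ((q⁻¹ : Aˣ) : A)) • (number q * number q) := by
  refine Finsupp.lhom_ext fun a x => ?_
  simp only [Module.End.mul_apply, LinearMap.smul_apply, LinearMap.add_apply, creation_single,
    annihilation_single, number_single, Finsupp.smul_single, smul_eq_mul]
  cases a with
  | zero =>
    simp only [mul_zero, pow_zero, sub_self, Finsupp.single_zero,
      zero_add, mul_one, Nat.sub_self]
    congr 1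
    linear_combination (x * (q : A)) * q.inv_mul
  | succ a =>
    simp only [Nat.add_sub_cancel, ← Finsupp.single_add]
    congr 1
    linear_combination (x * (q : A) ^ (2 * a + 3)) * q.inv_mul

end Fock

open scoped TensorProduct

theorem Module.End.list_prod_apply_of_intertwine {A P Q ι : Type*} [CommSemiring A]
    [AddCommMonoid P] [AddCommMonoid Q] [Module A P] [Module A Q] (J : P →ₗ[A] Q)
    {f : ι → Module.End A P} {g : ι → Module.End A Q} (h : ∀ i x, g i (J x) = J (f i x))
    (s : List ι) (x : P) : (s.map g).prod (J x) = J ((s.map f).prod x) := by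
  induction s with
  | nil => simp
  | cons a s ih => simp [ih, h]

theorem Module.End.pow_apply_of_intertwine {A P Q : Type*} [CommSemiring A]
    [AddCommMonoid P] [AddCommMonoid Q] [Module A P] [Module A Q] (J : P →ₗ[A] Q)
    {f : Module.End A P} {g : Module.End A Q} (h : ∀ x, g (J x) = J (f x))
    (m : ℕ) (x : P) : (g ^ m) (J x) = J ((f ^ m) x) := by
  induction m with
  | zero => simp
  | succ m ih => simp [pow_succ', ih, h]

@[simp] theorem Module.End.rTensorAlgHom_tmul {A P Q : Type*} [CommSemiring A]
    [AddCommMonoid P] [AddCommMonoid Q] [Module A P] [Module A Q] (f : Module.End A P)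
    (x : P) (y : Q) : Module.End.rTensorAlgHom A P Q f (x ⊗ₜ[A] y) = f x ⊗ₜ[A] y := rfl

@[simp] theorem Module.End.lTensorAlgHom_tmul {A P Q : Type*} [CommSemiring A]
    [AddCommMonoid P] [AddCommMonoid Q] [Module A P] [Module A Q] (g : Module.End A Q)
    (x : P) (y : Q) : Module.End.lTensorAlgHom A Q P g (x ⊗ₜ[A] y) = x ⊗ₜ[A] g y := rfl

theorem TensorProduct.commute_rTensorAlgHom_lTensorAlgHom {A P Q : Type*} [CommSemiring A]
    [AddCommMonoid P] [AddCommMonoid Q] [Module A P] [Module A Q] (f : Module.End A P)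
    (g : Module.End A Q) :
    Commute (Module.End.rTensorAlgHom A P Q f) (Module.End.lTensorAlgHom A Q P g) := by
  refine TensorProduct.ext' fun x y => ?_
  simp only [Module.End.mul_apply, Module.End.rTensorAlgHom_tmul, Module.End.lTensorAlgHom_tmul]

open IsQuantumMatrix in
theorem exists_isQuantumMatrix_column.{u} {A : Type u} [CommRing A] (q : Aˣ) (k : ℕ) :
    ∃ (P : Type u) (_ : AddCommGroup P) (_ : Module A P)
      (L : Fin k → Fin (k + 1) → Module.End A P) (v : P) (b : Module.Basis (Fin k → ℕ) A P),
      IsQuantumMatrix q L ∧ (∀ i j, L i j.succ v = if i = j then v else 0) ∧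
        ∀ a, b a = ((List.finRange k).map fun i => L i 0 ^ a i).prod v := by
  induction k with
  | zero =>
    refine ⟨A, inferInstance, inferInstance, Fin.elim0, 1, Module.Basis.singleton _ A,
      fun i => i.elim0, fun i => i.elim0, fun a => ?_⟩
    simp
  | succ k ih =>
    obtain ⟨P, _, _, L, v, b, hL, hv, hb⟩ := ih
    let φ := Module.End.rTensorAlgHom A P (ℕ →₀ A)
    let ψ := Module.End.lTensorAlgHom A (ℕ →₀ A) P
    let U := corner fun i j => φ (L i j)
    let V := oscillator k (ψ (Fock.creation A)) (ψ (Fock.number q)) (ψ (Fock.annihilation q))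
    have hφψ (f g) : Commute (φ f) (ψ g) :=
      TensorProduct.commute_rTensorAlgHom_lTensorAlgHom f g
    have hUV (i a b j) : Commute (U i a) (V b j) := by
      cases i using Fin.cases <;> cases a using Fin.cases <;> cases b using Fin.casesTwo <;>
        cases j using Fin.casesTwo <;>
        simp [U, V, corner, oscillator, hφψ, -Fin.succ_zero_eq_one, -Fin.succ_zero_eq_one']
      split_ifs <;> simp
    have hU : IsQuantumMatrix q U := isQuantumMatrix_corner (hL.map φ)
    have hV : IsQuantumMatrix q V := by
      refine isQuantumMatrix_oscillator k ?_ ?_ ?_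
      · rw [← map_mul, Fock.number_mul_creation, map_smul, map_mul]
      · rw [← map_mul, Fock.annihilation_mul_number, map_smul, map_mul]
      · rw [← map_mul, Fock.annihilation_mul_creation, map_add, map_smul, map_mul, map_mul]
    let e : P →ₗ[A] P ⊗[A] (ℕ →₀ A) := (TensorProduct.mk A P (ℕ →₀ A)).flip (Finsupp.single 0 1)
    refine ⟨P ⊗[A] (ℕ →₀ A), inferInstance, inferInstance, fun i j => ∑ a, U i a * V a j,
      e v, (b.tensorProduct Finsupp.basisSingleOne).reindex
        ((Equiv.prodComm _ _).trans (Fin.consEquiv fun _ => ℕ)), hU.mul hV hUV, ?_, ?_⟩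
    · intro i j
      cases i using Fin.cases <;> cases j using Fin.cases <;>
        simp [U, V, e, φ, ψ, corner, oscillator, Fin.sum_univ_succ,
          -Module.End.rTensorAlgHom_apply_apply, -Module.End.lTensorAlgHom_apply_apply]
      · intro h
        exact absurd h (Fin.succ_ne_zero _).symm
      · rw [hv]
        split_ifs <;> simp
    · intro a
      have h₀ : ∑ c, U 0 c * V c 0 = ψ (Fock.creation A) := by
        simp [U, V, corner, oscillator, Fin.sum_univ_succ]
      have h₁ (i : Fin k) : ∑ c, U i.succ c * V c 0 = φ (L i 0) * ψ (Fock.number q) := by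
        simp [U, V, corner, oscillator, Fin.sum_univ_succ]
      have h₂ (x : P) (m s : ℕ) : (ψ (Fock.creation A) ^ m) (x ⊗ₜ[A] Finsupp.single s 1) =
          x ⊗ₜ[A] Finsupp.single (s + m) 1 := by
        induction m with
        | zero => simp
        | succ m ih =>
          rw [pow_succ', Module.End.mul_apply, ih, Module.End.lTensorAlgHom_tmul,
            Fock.creation_single, add_assoc]
      have h₃ (i : Fin k) (x : P) : (φ (L i 0) * ψ (Fock.number q)) (e x) = e (L i 0 x) := by
        simp [e, φ, ψ, -Module.End.rTensorAlgHom_apply_apply,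
          -Module.End.lTensorAlgHom_apply_apply]
      simp only [List.finRange_succ, List.map_cons, List.prod_cons, List.map_map,
        Function.comp_def, h₀, h₁]
      rw [Module.End.mul_apply, Module.End.list_prod_apply_of_intertwine e
        (fun i => Module.End.pow_apply_of_intertwine e (h₃ i) (a i.succ)), ← hb]
      simp only [e, LinearMap.flip_apply, TensorProduct.mk_apply, h₂]
      simp only [Module.Basis.reindex_apply, zero_add]
      exact (b.tensorProduct_apply _ _ _).trans (by rw [Finsupp.coe_basisSingleOne]; rfl)

open IsQuantumMatrix in
theorem exists_isQuantumMatrix_grid.{u} {A : Type u} [CommRing A] (q : Aˣ) (k n : ℕ) :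
    ∃ (M : Type u) (_ : AddCommGroup M) (_ : Module A M)
      (T : Fin k → Fin n → Module.End A M) (w : M) (b : Module.Basis (Fin n → Fin k → ℕ) A M),
      IsQuantumMatrix q T ∧
        ∀ m, b m = ((List.finRange n).map fun j =>
          ((List.finRange k).map fun i => T i j ^ m j i).prod).prod w := by
  obtain ⟨P, _, _, L, v, c, hL, hv, hc⟩ := exists_isQuantumMatrix_column q k
  induction n with
  | zero =>
    refine ⟨A, inferInstance, inferInstance, fun _ => Fin.elim0, 1, Module.Basis.singleton _ A,
      fun _ _ j => j.elim0, fun a => ?_⟩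
    simp
  | succ n ih =>
    obtain ⟨M, _, _, T, w, b, hT, hb⟩ := ih
    let φ := Module.End.rTensorAlgHom A P M
    let ψ := Module.End.lTensorAlgHom A M P
    let U i j := φ (L i j)
    let V := corner fun i j => ψ (T i j)
    have hUV (i a b j) : Commute (U i a) (V b j) := by
      have hφψ (f g) : Commute (φ f) (ψ g) :=
        TensorProduct.commute_rTensorAlgHom_lTensorAlgHom f g
      cases b using Fin.cases <;> cases j using Fin.cases <;> simp [U, V, corner, hφψ]
    let e : M →ₗ[A] P ⊗[A] M := TensorProduct.mk A P M v
    refine ⟨P ⊗[A] M, inferInstance, inferInstance, fun i j => ∑ a, U i a * V a j, e w,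
      (c.tensorProduct b).reindex (Fin.consEquiv fun _ => Fin k → ℕ),
      (hL.map φ).mul (isQuantumMatrix_corner (hT.map ψ)) hUV, fun m => ?_⟩
    have h₀ (i : Fin k) : ∑ a, U i a * V a 0 = φ (L i 0) := by
      simp [U, V, corner, Fin.sum_univ_succ]
    have h₁ (i : Fin k) (j : Fin n) (x : M) :
        (∑ a, U i a * V a j.succ) (e x) = e (T i j x) := by
      simp [U, V, e, φ, ψ, corner, Fin.sum_univ_succ, hv, TensorProduct.ite_tmul,
        -Module.End.rTensorAlgHom_apply_apply, -Module.End.lTensorAlgHom_apply_apply]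
    have h₂ (i : Fin k) (x : P) (y : M) :
        φ (L i 0) ((TensorProduct.mk A P M).flip y x) =
          (TensorProduct.mk A P M).flip y (L i 0 x) := rfl
    simp only [List.finRange_succ, List.map_cons, List.prod_cons, List.map_map,
      Function.comp_def, h₀]
    rw [Module.End.mul_apply, Module.End.list_prod_apply_of_intertwine e
      (fun j => Module.End.list_prod_apply_of_intertwine e
        (fun i => Module.End.pow_apply_of_intertwine e (h₁ i j) (m j.succ i)) _), ← hb]
    have h₃ : e (b fun j => m j.succ) =
        (TensorProduct.mk A P M).flip (b fun j => m j.succ) v := rfl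
    rw [h₃, Module.End.list_prod_apply_of_intertwine _
      (fun i => Module.End.pow_apply_of_intertwine _ (fun x => h₂ i x _) (m 0 i)), ← hc]
    simp [Fin.consEquiv, Module.Basis.tensorProduct_apply]
    rfl

namespace QMat

theorem linearIndependent_monomial {A : Type*} [CommRing A] (q : Aˣ) (k n : ℕ) :
    LinearIndependent A (monomial A q k n) := by
  obtain ⟨M, _, _, T, w, b, hT, hb⟩ := exists_isQuantumMatrix_grid q k n
  let F := FreeAlgebra.lift A fun p : Fin k × Fin n => T p.1 p.2
  have hF : ∀ ⦃x y⦄, QMatRel A q k n x y → F x = F y := by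
    intro x y h
    induction h with
    | comm i r j l h =>
      have := hT i r j l
      rcases h with ⟨h₁, h₂⟩ | ⟨h₁, h₂⟩
      · simpa [F, h₁, h₂, h₁.ne, h₂.ne'] using this
      · simpa [F, h₁.ne', h₂.ne, h₁.not_gt, h₂.not_gt] using this
    | qcomm i r j l h =>
      have := hT i r j l
      rcases h with ⟨h₁, rfl⟩ | ⟨rfl, h₂⟩
      · simp only [h₁, h₁.ne, if_true, if_false, one_smul, lt_irrefl, zero_smul, add_zero] at this
        rw [← eq_sub_iff_add_eq, ← sub_smul, sub_sub_cancel] at this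
        simpa [F] using this
      · simp only [h₂.ne, h₂.not_gt, if_true, if_false, one_smul, lt_irrefl, zero_smul,
          add_zero] at this
        simp [F, ← this, smul_smul]
    | cross i r j l h =>
      have := hT i r j l
      simp only [h.1, h.1.ne, h.2.ne, h.2.not_gt, if_true, if_false, one_smul, zero_smul,
        add_zero] at this
      simpa [F] using eq_sub_of_add_eq this
  let ρ : QMat A q k n →ₐ[A] Module.End A M := RingQuot.liftAlgHom A ⟨F, hF⟩
  have hρ (i j) : ρ (X A q k n i j) = T i j := by
    simp [ρ, X, F]
  have hρm (m) : ρ (monomial A q k n m) w = b fun j i => m (i, j) := by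
    rw [hb, monomial]
    simp only [map_list_prod, List.map_map, Function.comp_def, map_pow, hρ]
  refine LinearIndependent.of_comp ((LinearMap.applyₗ w).comp ρ.toLinearMap) ?_
  have : ((LinearMap.applyₗ w).comp ρ.toLinearMap) ∘ monomial A q k n =
      b ∘ fun m j i => m (i, j) := funext hρm
  rw [this]
  refine b.linearIndependent.comp _ fun m m' h => ?_
  ext ⟨i, j⟩
  exact congrFun (congrFun h j) i

theorem X_mul_X_of_lt_of_gt {A : Type*} [CommRing A] (q : Aˣ) {k n : ℕ} {i r : Fin k}
    {j l : Fin n} (h : (i < r ∧ l < j) ∨ (r < i ∧ j < l)) :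
    X A q k n i j * X A q k n r l = X A q k n r l * X A q k n i j := by
  simpa [X] using RingQuot.mkAlgHom_rel A (QMatRel.comm (A := A) (q := q) i r j l h)

theorem X_mul_X_of_eq_or_eq {A : Type*} [CommRing A] (q : Aˣ) {k n : ℕ} {i r : Fin k}
    {j l : Fin n} (h : (i < r ∧ j = l) ∨ (i = r ∧ j < l)) :
    X A q k n r l * X A q k n i j = (q : A) • (X A q k n i j * X A q k n r l) := by
  have := RingQuot.mkAlgHom_rel A (QMatRel.qcomm (A := A) (q := q) i r j l h)
  simp only [map_mul, map_smul] at this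
  rw [X, X, this, smul_smul, q.mul_inv, one_smul]

theorem X_mul_X_of_lt_of_lt {A : Type*} [CommRing A] (q : Aˣ) {k n : ℕ} {i r : Fin k}
    {j l : Fin n} (h : i < r ∧ j < l) :
    X A q k n r l * X A q k n i j = X A q k n i j * X A q k n r l +
      ((q : A) - ((q⁻¹ : Aˣ) : A)) • (X A q k n r j * X A q k n i l) := by
  have := RingQuot.mkAlgHom_rel A (QMatRel.cross (A := A) (q := q) i r j l h)
  simp only [map_mul, map_smul, map_sub] at this
  exact (sub_eq_iff_eq_add.1 this.symm)

theorem iSup_pow_iSup_span_X {A : Type*} [CommRing A] (q : Aˣ) (k n : ℕ) :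
    (⨆ m : ℕ, (⨆ j, ⨆ i, Submodule.span A {X A q k n i j}) ^ m) = ⊤ := by
  set Y := ⨆ j, ⨆ i, Submodule.span A {X A q k n i j} with hY
  have hX (i j) : X A q k n i j ∈ Y :=
    Submodule.mem_iSup_of_mem j (Submodule.mem_iSup_of_mem i (Submodule.mem_span_singleton_self _))
  have key (x : FreeAlgebra A (Fin k × Fin n)) : ∀ s ∈ ⨆ m : ℕ, Y ^ m,
      RingQuot.mkAlgHom A (QMatRel A q k n) x * s ∈ ⨆ m : ℕ, Y ^ m := by
    induction x with
    | grade0 a =>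
      intro s hs
      rw [AlgHom.commutes, ← Algebra.smul_def]
      exact Submodule.smul_mem _ a hs
    | grade1 p =>
      exact fun s hs => Submodule.mul_iSup_pow_self_le Y (Submodule.mul_mem_mul (hX p.1 p.2) hs)
    | mul x y hx hy =>
      intro s hs
      rw [map_mul, mul_assoc]
      exact hx _ (hy s hs)
    | add x y hx hy =>
      intro s hs
      rw [map_add, add_mul]
      exact add_mem (hx s hs) (hy s hs)
  refine eq_top_iff.2 fun z _ => ?_
  obtain ⟨x, rfl⟩ := RingQuot.mkAlgHom_surjective A (QMatRel A q k n) z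
  simpa using key x 1 (Submodule.one_le.1 (Submodule.one_le_iSup_pow Y))

theorem span_range_monomial {A : Type*} [CommRing A] (q : Aˣ) (k n : ℕ) :
    Submodule.span A (Set.range (monomial A q k n)) = ⊤ := by
  let Y (j : Fin n) : Submodule A (QMat A q k n) := ⨆ i, Submodule.span A {X A q k n i j}
  have hX (i j) : X A q k n i j ∈ Y j :=
    Submodule.mem_iSup_of_mem i (Submodule.mem_span_singleton_self _)
  have hcol (j l : Fin n) (hjl : j < l) : Y l * Y j ≤ Y j * Y l := by
    have h (r i : Fin k) : X A q k n r l * X A q k n i j ∈ Y j * Y l := by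
      have hmem (r i) : X A q k n r j * X A q k n i l ∈ Y j * Y l :=
        Submodule.mul_mem_mul (hX r j) (hX i l)
      rcases lt_trichotomy i r with hir | rfl | hir
      · rw [X_mul_X_of_lt_of_lt q ⟨hir, hjl⟩]
        exact add_mem (hmem i r) (Submodule.smul_mem _ _ (hmem r i))
      · rw [X_mul_X_of_eq_or_eq q (.inr ⟨rfl, hjl⟩)]
        exact Submodule.smul_mem _ _ (hmem i i)
      · rw [X_mul_X_of_lt_of_gt q (.inl ⟨hir, hjl⟩)]
        exact hmem i r
    change (⨆ r, _) * (⨆ i, _) ≤ _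
    rw [Submodule.iSup_mul]
    refine iSup_le fun r => ?_
    rw [Submodule.mul_iSup]
    refine iSup_le fun i => ?_
    rw [Submodule.span_mul_span, Set.singleton_mul_singleton,
      Submodule.span_singleton_le_iff_mem]
    exact h r i
  have hrow (j : Fin n) (i r : Fin k) (hir : i < r) :
      Submodule.span A {X A q k n r j} * Submodule.span A {X A q k n i j} ≤
        Submodule.span A {X A q k n i j} * Submodule.span A {X A q k n r j} := by
    rw [Submodule.span_mul_span, Submodule.span_mul_span, Set.singleton_mul_singleton,
      Set.singleton_mul_singleton, Submodule.span_singleton_le_iff_mem,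
      X_mul_X_of_eq_or_eq q (.inl ⟨hir, rfl⟩)]
    exact Submodule.smul_mem _ _ (Submodule.mem_span_singleton_self _)
  have hY (j : Fin n) : (⨆ m : ℕ, Y j ^ m) ≤ Submodule.span A (Set.range fun a : Fin k → ℕ =>
      ((List.finRange k).map fun i => X A q k n i j ^ a i).prod) := by
    refine (Submodule.iSup_pow_iSup_le _ (hrow j)).trans ?_
    simp only [Submodule.iSup_pow_span_singleton]
    exact Submodule.list_prod_span_range_le _ _ (List.nodup_finRange k)
  rw [eq_top_iff, ← iSup_pow_iSup_span_X]
  calc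
    _ ≤ ((List.finRange n).map fun j => ⨆ m : ℕ, Y j ^ m).prod :=
      Submodule.iSup_pow_iSup_le Y hcol
    _ ≤ ((List.finRange n).map fun j => Submodule.span A (Set.range fun a : Fin k → ℕ =>
          ((List.finRange k).map fun i => X A q k n i j ^ a i).prod)).prod :=
      List.Forall₂.prod_le_prod' (by simpa [List.forall₂_same] using hY)
    _ ≤ _ := Submodule.list_prod_span_range_le _ _ (List.nodup_finRange n)
    _ ≤ _ := by
      refine Submodule.span_mono ?_
      rintro _ ⟨g, rfl⟩
      exact ⟨fun p => g p.2 p.1, rfl⟩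

end QMat

/-- Parshall–Wang basis theorem: the ordered monomials `X^m`,
`m : Fin k × Fin n → ℕ`, form an `A`-module basis of `S_q(k,n)`: they are
`A`-linearly independent and span `S_q(k,n)` over `A`. -/
theorem QMat.monomial_isBasis (A : Type*) [CommRing A] (q : Aˣ) (k n : ℕ)
    (hk : 1 ≤ k) (hn : 1 ≤ n) :
    LinearIndependent A (QMat.monomial A q k n) ∧
      Submodule.span A (Set.range (QMat.monomial A q k n)) = ⊤ :=
  ⟨QMat.linearIndependent_monomial q k n, QMat.span_range_monomial q k n⟩
end

section
/- For each 1 ≤ j ≤ n there is a unique A-algebra homomorphism c_j : S_q(k,1) → S_q(k,n) with c_j(X_{i1}) = X_{ij} for all 1 ≤ i ≤ k, and the A-linear map Φ : S_q(k,1)^{⊗_A n} → S_q(k,n) determined by Φ(p_1 ⊗ ⋯ ⊗ p_n) = c_1(p_1)·c_2(p_2)⋯c_n(p_n) is an isomorphism of A-modules. -/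
namespace QMat

/-- The defining relations of `S_q(k,n)`, for a family of elements `B i j r l` of a module that
play the role of the products `X_{ij} X_{rl}`. The commutation relations of entries in different
columns are combined into the single rule `exch`. -/
structure Relations {A : Type*} [CommRing A] (q : Aˣ) {k n : ℕ} {M : Type*} [AddCommGroup M]
    [Module A M] (B : Fin k → Fin n → Fin k → Fin n → M) : Prop where
  col : ∀ {i r : Fin k} (j : Fin n), i < r → B i j r j = ((q⁻¹ : Aˣ) : A) • B r j i j
  exch : ∀ (i r : Fin k) {j l : Fin n}, j < l →
    B i j r l = (if i = r then ((q⁻¹ : Aˣ) : A) else 1) • B r l i j -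
      (if i < r then (q : A) - ((q⁻¹ : Aˣ) : A) else 0) • B i l r j

variable {A : Type*} [CommRing A] {q : Aˣ} {k n : ℕ}

namespace Relations

variable {M N : Type*} [AddCommGroup M] [Module A M] [AddCommGroup N] [Module A N]

theorem zero : Relations q (fun (_ : Fin k) (_ : Fin n) _ _ => (0 : M)) :=
  ⟨fun _ _ => by simp, fun _ _ _ _ _ => by simp⟩

theorem add {B C : Fin k → Fin n → Fin k → Fin n → M} (hB : Relations q B)
    (hC : Relations q C) : Relations q fun i j r l => B i j r l + C i j r l where
  col j h := by rw [hB.col j h, hC.col j h, smul_add]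
  exch i r j l h := by rw [hB.exch i r h, hC.exch i r h]; module

theorem map {B : Fin k → Fin n → Fin k → Fin n → M} (hB : Relations q B) (f : M →ₗ[A] N) :
    Relations q fun i j r l => f (B i j r l) where
  col j h := by rw [hB.col j h, map_smul]
  exch i r j l h := by rw [hB.exch i r h, map_sub, map_smul, map_smul]

/-- The relations are stable under exchanging two generators with an entry of a column further to
the left; this is the Yang-Baxter equation. -/
theorem exchange {B : Fin k → Fin n → Fin k → Fin n → M} (hB : Relations q B)
    (x : Fin k → M →ₗ[A] N) (t : Fin k) :
    Relations q fun i j r l =>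
      (if r = t then (q : A) else 1) • ((if i = t then (q : A) else 1) • x t (B i j r l) +
        (if t < i then (q : A) - ((q⁻¹ : Aˣ) : A) else 0) • x i (B t j r l)) +
      (if t < r then (q : A) - ((q⁻¹ : Aˣ) : A) else 0) •
        ((if i = r then (q : A) else 1) • x r (B i j t l) +
        (if r < i then (q : A) - ((q⁻¹ : Aˣ) : A) else 0) • x i (B r j t l)) := by
  have hq : (q : A) * ((q⁻¹ : Aˣ) : A) = 1 := q.mul_inv
  constructor
  · intro i r j h
    rcases lt_trichotomy t i with h₁ | rfl | h₁ <;>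
    rcases lt_trichotomy t r with h₂ | rfl | h₂ <;>
    first
    | (exfalso; order)
    | (simp only [hB.col j, map_smul, *]; match_scalars <;> grind)
  · intro i r j l hjl
    simp only [hB.exch _ _ hjl, map_sub, map_smul]
    rcases lt_trichotomy t i with h₁ | h₁ | h₁ <;>
    rcases lt_trichotomy t r with h₂ | h₂ | h₂ <;>
    rcases lt_trichotomy i r with h₃ | h₃ | h₃ <;>
    first
    | (exfalso; order)
    | (subst_vars; match_scalars <;> grind)

end Relations

theorem X_comm {i r : Fin k} {j l : Fin n} (hr : i < r) (hl : l < j) :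
    X A q k n i j * X A q k n r l = X A q k n r l * X A q k n i j := by
  simpa only [X, map_mul] using RingQuot.mkAlgHom_rel A
    (QMatRel.comm (A := A) (q := q) i r j l (Or.inl ⟨hr, hl⟩))

theorem X_col {i r : Fin k} (j : Fin n) (hr : i < r) :
    X A q k n i j * X A q k n r j = ((q⁻¹ : Aˣ) : A) • (X A q k n r j * X A q k n i j) := by
  simpa only [X, map_mul, map_smul] using RingQuot.mkAlgHom_rel A
    (QMatRel.qcomm (A := A) (q := q) i r j j (Or.inl ⟨hr, rfl⟩))

theorem X_row (i : Fin k) {j l : Fin n} (hl : j < l) :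
    X A q k n i j * X A q k n i l = ((q⁻¹ : Aˣ) : A) • (X A q k n i l * X A q k n i j) := by
  simpa only [X, map_mul, map_smul] using RingQuot.mkAlgHom_rel A
    (QMatRel.qcomm (A := A) (q := q) i i j l (Or.inr ⟨rfl, hl⟩))

theorem X_cross {i r : Fin k} {j l : Fin n} (hr : i < r) (hl : j < l) :
    X A q k n i j * X A q k n r l = X A q k n r l * X A q k n i j -
      ((q : A) - ((q⁻¹ : Aˣ) : A)) • (X A q k n r j * X A q k n i l) := by
  simpa only [X, map_mul, map_smul, map_sub] using RingQuot.mkAlgHom_rel A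
    (QMatRel.cross (A := A) (q := q) i r j l ⟨hr, hl⟩)

theorem relations_X : Relations q fun i j r l => X A q k n i j * X A q k n r l where
  col := X_col
  exch i r j l h := by
    rcases lt_trichotomy i r with hi | rfl | hi
    · simp [hi, hi.ne, X_cross hi h, X_comm hi h]
    · simp [X_row i h]
    · simp [hi.ne', hi.not_gt, X_comm hi h]

/-- The universal property of `S_q(k,n)`. -/
noncomputable def lift {B : Type*} [Ring B] [Algebra A B] (f : Fin k → Fin n → B)
    (hf : Relations q fun i j r l => f i j * f r l) : QMat A q k n →ₐ[A] B :=
  RingQuot.liftAlgHom A ⟨FreeAlgebra.lift A fun x => f x.1 x.2, by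
    have comm {i r : Fin k} {j l : Fin n} (hi : i < r) (h : l < j) :
        f r l * f i j = f i j * f r l := by
      simpa [hi.ne', hi.not_gt] using hf.exch r i h
    rintro _ _ (⟨i, r, j, l, h | h⟩ | ⟨i, r, j, l, ⟨h, rfl⟩ | ⟨rfl, h⟩⟩ | ⟨i, r, j, l, h⟩)
    · simpa using (comm h.1 h.2).symm
    · simpa using comm h.1 h.2
    · simpa using hf.col _ h
    · simpa using hf.exch i i h
    · simpa [h.1, h.1.ne, comm h.1 h.2] using hf.exch i r h.2⟩

@[simp]
theorem lift_X {B : Type*} [Ring B] [Algebra A B] (f : Fin k → Fin n → B)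
    (hf : Relations q fun i j r l => f i j * f r l) (i : Fin k) (j : Fin n) :
    lift f hf (X A q k n i j) = f i j := by
  simp [lift, X]

theorem algHom_ext {B : Type*} [Semiring B] [Algebra A B] {f g : QMat A q k n →ₐ[A] B}
    (h : ∀ i j, f (X A q k n i j) = g (X A q k n i j)) : f = g := by
  apply RingQuot.ringQuot_ext' A
  ext ⟨i, j⟩
  exact h i j

theorem adjoin_X :
    Algebra.adjoin A (Set.range fun x : Fin k × Fin n => X A q k n x.1 x.2) = ⊤ := by
  have h : Set.range (fun x : Fin k × Fin n => X A q k n x.1 x.2) =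
      RingQuot.mkAlgHom A (QMatRel A q k n) '' Set.range (FreeAlgebra.ι A) := by
    rw [← Set.range_comp]; rfl
  rw [h, ← AlgHom.map_adjoin, FreeAlgebra.adjoin_range_ι, Algebra.map_top,
    AlgHom.range_eq_top]
  exact RingQuot.mkAlgHom_surjective A _

end QMat

/-- A linear property holds for all elements of an algebra if it holds for `1` and is preserved by
left multiplication by a family of generators. -/
theorem Algebra.induction_mul_left {R B ι : Type*} [CommSemiring R] [Semiring B] [Algebra R B]
    {x : ι → B} (hx : Algebra.adjoin R (Set.range x) = ⊤) {C : B → Prop} (one : C 1)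
    (add : ∀ a b, C a → C b → C (a + b)) (smul : ∀ (c : R) a, C a → C (c • a))
    (gen_mul : ∀ i a, C a → C (x i * a)) (a : B) : C a := by
  suffices h : ∀ b, C b → C (a * b) by simpa using h 1 one
  have ha : a ∈ Algebra.adjoin R (Set.range x) := by rw [hx]; trivial
  induction ha using Algebra.adjoin_induction with
  | mem x hx => obtain ⟨x, rfl⟩ := hx; exact gen_mul _
  | algebraMap r => intro b hb; rw [← Algebra.smul_def]; exact smul _ _ hb
  | add x y _ _ hx hy => intro b hb; rw [add_mul]; exact add _ _ (hx b hb) (hy b hb)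
  | mul x y _ _ hx hy => intro b hb; rw [mul_assoc]; exact hx _ (hy b hb)

namespace QMat

open TensorProduct

section Exchange

variable {A : Type*} [CommRing A] {q : Aˣ} {k n : ℕ} {P N : Type*} [Ring P] [Algebra A P] [Ring N]
  [Algebra A N]

/-- The matrix of coefficients that appears when a column of generators is moved past the entry
`x t` of a column further to the left. -/
def exchangeMatrix (q : Aˣ) (x : Fin k → P) (t : Fin k) : Matrix (Fin k) (Fin k) P := fun i s =>
  (if i = s then (if i = t then (q : A) else 1) else 0) • x t +
    (if t < i ∧ t = s then (q : A) - ((q⁻¹ : Aˣ) : A) else 0) • x i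

theorem exchangeMatrix_mul_apply (x : Fin k → P) (t i s : Fin k) (m : Matrix (Fin k) (Fin k) P) :
    (exchangeMatrix q x t * m) i s =
      (if i = t then (q : A) else 1) • (x t * m i s) +
        (if t < i then (q : A) - ((q⁻¹ : Aˣ) : A) else 0) • (x i * m t s) := by
  simp only [Matrix.mul_apply, exchangeMatrix, add_mul, Finset.sum_add_distrib, ite_smul,
    zero_smul, ite_and]
  split_ifs <;> simp

theorem relations_exchangeMatrix {x : Fin k → P}
    (hx : Relations q fun i (_ : Fin 1) r _ => x i * x r) :
    Relations q fun i (_ : Fin 1) r _ => exchangeMatrix q x i * exchangeMatrix q x r where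
  col {a b} _ hab := by
    have hq : (q : A) * ((q⁻¹ : Aˣ) : A) = 1 := q.mul_inv
    have hX {i r : Fin k} (h : i < r) := hx.col 0 h
    ext i s
    simp only [exchangeMatrix_mul_apply, Matrix.smul_apply]
    simp only [exchangeMatrix, mul_add, mul_smul_comm]
    rcases lt_trichotomy i a with h₁ | h₁ | h₁ <;>
    rcases lt_trichotomy i b with h₂ | h₂ | h₂ <;>
    first
    | (exfalso; order)
    | (subst_vars; simp only [*]; match_scalars <;> grind)
  exch _ _ _ _ h := by simp [Subsingleton.elim _ (0 : Fin 1)] at h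

/-- The operator `∑ₛ L_{is} ⊗ y_{sj}` on `P ⊗ N`. -/
noncomputable def act (L : P →ₐ[A] Matrix (Fin k) (Fin k) P) (y : Fin k → Fin n → N) (i : Fin k)
    (j : Fin n) : Module.End A (P ⊗[A] N) :=
  ∑ s, TensorProduct.map (Matrix.entryLinearMap A _ i s ∘ₗ L.toLinearMap)
    (LinearMap.mulLeft A (y s j))

variable {L : P →ₐ[A] Matrix (Fin k) (Fin k) P} {x : Fin k → P} {y : Fin k → Fin n → N}

theorem act_tmul (i : Fin k) (j : Fin n) (p : P) (w : N) :
    act L y i j (p ⊗ₜ w) = ∑ s, L p i s ⊗ₜ (y s j * w) := by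
  simp [act]

theorem act_one_tmul (i : Fin k) (j : Fin n) (w : N) :
    act L y i j (1 ⊗ₜ w) = 1 ⊗ₜ (y i j * w) := by
  rw [act_tmul, map_one, Finset.sum_eq_single i]
  · simp
  · intro s _ h; simp [Matrix.one_apply_ne h.symm]
  · simp

theorem act_gen_mul (hL : ∀ t, L (x t) = exchangeMatrix q x t) (i t : Fin k) (j : Fin n)
    (v : P ⊗[A] N) :
    act L y i j ((x t ⊗ₜ 1) * v) =
      (if i = t then (q : A) else 1) • ((x t ⊗ₜ 1) * act L y i j v) +
        (if t < i then (q : A) - ((q⁻¹ : Aˣ) : A) else 0) •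
          ((x i ⊗ₜ 1) * act L y t j v) := by
  induction v with
  | zero => simp
  | add v w hv hw => simp only [mul_add, map_add, hv, hw, smul_add]; abel
  | tmul p w =>
    simp only [Algebra.TensorProduct.tmul_mul_tmul, one_mul, act_tmul, map_mul, hL,
      exchangeMatrix_mul_apply, add_tmul, Finset.sum_add_distrib, Finset.mul_sum,
      Finset.smul_sum, smul_tmul']

theorem tensor_induction (hx : Algebra.adjoin A (Set.range x) = ⊤) {C : P ⊗[A] N → Prop}
    (zero : C 0) (add : ∀ v w, C v → C w → C (v + w)) (smul : ∀ (c : A) v, C v → C (c • v))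
    (one_tmul : ∀ w, C (1 ⊗ₜ w)) (gen_mul : ∀ t v, C v → C ((x t ⊗ₜ 1) * v)) (v : P ⊗[A] N) :
    C v := by
  induction v with
  | zero => exact zero
  | add v w hv hw => exact add v w hv hw
  | tmul p w =>
    induction p using Algebra.induction_mul_left hx with
    | one => exact one_tmul w
    | add a b ha hb => rw [add_tmul]; exact add _ _ ha hb
    | smul c a ha => rw [← smul_tmul']; exact smul _ _ ha
    | gen_mul i a ha => simpa using gen_mul i _ ha

theorem relations_act (hL : ∀ t, L (x t) = exchangeMatrix q x t)
    (hx : Algebra.adjoin A (Set.range x) = ⊤) (hy : Relations q fun i j r l => y i j * y r l) :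
    Relations q fun i j r l => act L y i j * act L y r l := by
  suffices h : ∀ v, Relations q fun i j r l => (act L y i j * act L y r l) v from
    ⟨fun j hi => LinearMap.ext fun v => (h v).col j hi,
      fun i r _ _ hj => LinearMap.ext fun v => (h v).exch i r hj⟩
  intro v
  induction v using tensor_induction hx with
  | zero => simpa using Relations.zero
  | add v w hv hw => simpa using hv.add hw
  | smul c v hv => simpa using hv.map (LinearMap.lsmul A _ c)
  | one_tmul w =>
    simpa [act_one_tmul, mul_assoc] using hy.map
      (TensorProduct.mk A P N 1 ∘ₗ LinearMap.mulRight A w)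
  | gen_mul t v hv =>
    simpa only [Module.End.mul_apply, act_gen_mul hL, map_add, map_smul,
      LinearMap.mulLeft_apply] using
      hv.exchange (fun i => LinearMap.mulLeft A (x i ⊗ₜ[A] (1 : N))) t

/-- The matrix of operators on `P ⊗ N` whose first column consists of the multiplications by `x i`
and whose other columns are those of `act`. -/
noncomputable def actCons (L : P →ₐ[A] Matrix (Fin k) (Fin k) P) (x : Fin k → P)
    (y : Fin k → Fin n → N) (i : Fin k) : Fin (n + 1) → Module.End A (P ⊗[A] N) :=
  Fin.cons (LinearMap.mulLeft A (x i ⊗ₜ[A] (1 : N))) (act L y i)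

theorem relations_actCons (hL : ∀ t, L (x t) = exchangeMatrix q x t)
    (hx : Algebra.adjoin A (Set.range x) = ⊤)
    (hx' : Relations q fun i (_ : Fin 1) r _ => x i * x r)
    (hy : Relations q fun i j r l => y i j * y r l) :
    Relations q fun i j r l => actCons L x y i j * actCons L x y r l where
  col {i r} j h := by
    cases j using Fin.cases with
    | zero =>
      ext
      simp [actCons, ← mul_assoc, hx'.col 0 h, smul_tmul']
    | succ j => exact (relations_act hL hx hy).col j h
  exch i r j l h := by
    cases l using Fin.cases with
    | zero => simp at h
    | succ l =>
    cases j using Fin.cases with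
    | zero =>
      apply LinearMap.ext
      intro v
      have hq : (q : A) * ((q⁻¹ : Aˣ) : A) = 1 := q.mul_inv
      simp only [actCons, Fin.cons_zero, Fin.cons_succ, Module.End.mul_apply, LinearMap.sub_apply,
        LinearMap.smul_apply, LinearMap.mulLeft_apply, act_gen_mul hL]
      rcases lt_trichotomy i r with h | h | h <;>
      (subst_vars; match_scalars <;> grind)
    | succ j => exact (relations_act hL hx hy).exch i r (Fin.succ_lt_succ_iff.mp h)

/-- If `S_q(k,n+1)` acts on `P ⊗ N` by `actCons`, then the multiplication `P ⊗ N → S_q(k,n+1)` is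
an isomorphism. -/
theorem exists_mul_equiv (hL : ∀ t, L (x t) = exchangeMatrix q x t)
    (hx : Algebra.adjoin A (Set.range x) = ⊤)
    (hx' : Relations q fun i (_ : Fin 1) r _ => x i * x r)
    (hy : Relations q fun i j r l => y i j * y r l)
    (hy' : Algebra.adjoin A (Set.range fun a : Fin k × Fin n => y a.1 a.2) = ⊤)
    (c : P →ₐ[A] QMat A q k (n + 1)) (hc : ∀ i, c (x i) = X A q k (n + 1) i 0)
    (d : N →ₐ[A] QMat A q k (n + 1)) (hd : ∀ i j, d (y i j) = X A q k (n + 1) i j.succ) :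
    ∃ e : P ⊗[A] N ≃ₗ[A] QMat A q k (n + 1), ∀ p w, e (p ⊗ₜ w) = c p * d w := by
  let ρ := lift (actCons L x y) (relations_actCons hL hx hx' hy)
  have hρ0 (i) (v : P ⊗[A] N) : ρ (X A q k (n + 1) i 0) v = (x i ⊗ₜ 1) * v := by
    simp [ρ, actCons]
  have hρs (i j) (v : P ⊗[A] N) : ρ (X A q k (n + 1) i j.succ) v = act L y i j v := by
    simp [ρ, actCons]
  let μ : P ⊗[A] N →ₗ[A] QMat A q k (n + 1) :=
    TensorProduct.lift ((LinearMap.mul A _).compl₁₂ c.toLinearMap d.toLinearMap)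
  have hμ (p w) : μ (p ⊗ₜ w) = c p * d w := rfl
  have hμx (t v) : μ ((x t ⊗ₜ 1) * v) = X A q k (n + 1) t 0 * μ v := by
    induction v with
    | zero => simp
    | add v w hv hw => simp only [mul_add, map_add, hv, hw]
    | tmul p w => simp [hμ, hc, mul_assoc]
  have hμy (v i j) : μ (act L y i j v) = X A q k (n + 1) i j.succ * μ v := by
    induction v using tensor_induction hx generalizing i with
    | zero => simp
    | add v w hv hw => simp only [mul_add, map_add, hv, hw]
    | smul c v hv => simp only [map_smul, hv, mul_smul_comm]
    | one_tmul w => simp [act_one_tmul, hμ, hd]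
    | gen_mul t v hv =>
      have hq : (q : A) * ((q⁻¹ : Aˣ) : A) = 1 := q.mul_inv
      have h (a b : Fin k) := (relations_X (A := A) (q := q)).exch a b (Fin.succ_pos j)
      simp only [act_gen_mul hL, map_add, map_smul, hμx, hv, ← mul_assoc, h, sub_mul,
        smul_mul_assoc]
      rcases lt_trichotomy i t with h | h | h <;>
      (subst_vars; match_scalars <;> grind)
  have hμρ (a v) : μ (ρ a v) = a * μ v := by
    induction a using Algebra.induction_mul_left adjoin_X generalizing v with
    | one => simp
    | add a b ha hb => simp [ha, hb, add_mul]
    | smul c a ha => simp [ha]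
    | gen_mul ij a ha =>
      obtain ⟨i, j⟩ := ij
      cases j using Fin.cases with
      | zero => simp [hρ0, hμx, ha, mul_assoc]
      | succ j => simp [hρs, hμy, ha, mul_assoc]
  have hρc (p v) : ρ (c p) v = (p ⊗ₜ 1) * v := by
    induction p using Algebra.induction_mul_left hx generalizing v with
    | one => simp [← Algebra.TensorProduct.one_def]
    | add a b ha hb => simp [ha, hb, add_tmul, add_mul]
    | smul c a ha => simp [ha, ← smul_tmul']
    | gen_mul i a ha => simp [hc, hρ0, ha, ← mul_assoc]
  have hρd (w w') : ρ (d w) (1 ⊗ₜ w') = 1 ⊗ₜ (w * w') := by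
    induction w using Algebra.induction_mul_left hy' generalizing w' with
    | one => simp
    | add a b ha hb => simp [ha, hb, tmul_add, add_mul]
    | smul c a ha => simp [ha]
    | gen_mul i a ha => simp [hd, hρs, ha, act_one_tmul, mul_assoc]
  refine ⟨LinearEquiv.ofLinearMap μ (LinearMap.applyₗ (1 : P ⊗[A] N) ∘ₗ ρ.toLinearMap) ?_ ?_, hμ⟩
  · ext a
    simp [hμρ, Algebra.TensorProduct.one_def, hμ]
  · ext p w
    simp [hμ, hρc, hρd, Algebra.TensorProduct.one_def]

end Exchange

end QMat

open scoped TensorProduct in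
/-- The tensor power with `n + 1` factors is the tensor product of its first factor and the tensor
power of the others. -/
theorem PiTensorProduct.exists_finSucc_equiv (R M : Type*) [CommRing R] [AddCommGroup M]
    [Module R M] (n : ℕ) :
    ∃ e : PiTensorProduct R (fun _ : Fin (n + 1) => M) ≃ₗ[R]
        M ⊗[R] PiTensorProduct R (fun _ : Fin n => M),
      ∀ p, e (tprod R p) = p 0 ⊗ₜ tprod R fun j => p j.succ := by
  let σ : Fin (n + 1) ≃ PUnit.{1} ⊕ Fin n :=
    (finSuccEquiv n).trans ((Equiv.optionEquivSumPUnit _).trans (Equiv.sumComm _ _))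
  refine ⟨(reindex R (fun _ => M) σ).trans ((tmulEquiv R M).symm.trans
    (TensorProduct.congr (subsingletonEquiv PUnit.unit) (LinearEquiv.refl R _))), fun p => ?_⟩
  simp [σ]

namespace QMat

open TensorProduct

variable {A : Type*} [CommRing A] {q : Aˣ} {k m n : ℕ}

/-- The homomorphism `S_q(k,m) → S_q(k,n)` that sends the columns, in order, to those of indices
given by `f`. -/
noncomputable def mapCols (f : Fin m ↪o Fin n) : QMat A q k m →ₐ[A] QMat A q k n :=
  lift (fun i j => X A q k n i (f j))
    ⟨fun j h => relations_X.col (f j) h, fun i r _ _ h => relations_X.exch i r (f.strictMono h)⟩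

@[simp]
theorem mapCols_X (f : Fin m ↪o Fin n) (i : Fin k) (j : Fin m) :
    mapCols f (X A q k m i j) = X A q k n i (f j) := by
  simp [mapCols]

/-- The homomorphism from the quantum affine space to `S_q(k,n)` given by the column `j`. -/
noncomputable def col (j : Fin n) : QMat A q k 1 →ₐ[A] QMat A q k n :=
  mapCols (OrderEmbedding.ofStrictMono (fun _ => j) (Subsingleton.strictMono _))

@[simp]
theorem col_X (i : Fin k) (j : Fin n) : col j (X A q k 1 i 0) = X A q k n i j := by
  simp [col]

theorem algHom_ext_one {B : Type*} [Semiring B] [Algebra A B] {f g : QMat A q k 1 →ₐ[A] B}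
    (h : ∀ i, f (X A q k 1 i 0) = g (X A q k 1 i 0)) : f = g :=
  algHom_ext fun i j => by rw [Subsingleton.elim j 0, h]

theorem mapCols_succ_col (j : Fin n) (p : QMat A q k 1) :
    mapCols (Fin.succOrderEmb n) (col j p) = col j.succ p :=
  DFunLike.congr_fun (algHom_ext_one (f := (mapCols (Fin.succOrderEmb n)).comp (col j))
    (by simp)) p

variable (A q k) in
theorem exists_col_mul_equiv (n : ℕ) :
    ∃ e : QMat A q k 1 ⊗[A] QMat A q k n ≃ₗ[A] QMat A q k (n + 1),
      ∀ p w, e (p ⊗ₜ w) = col 0 p * mapCols (Fin.succOrderEmb n) w := by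
  have hx : Relations q fun i (_ : Fin 1) r _ => X A q k 1 i 0 * X A q k 1 r 0 :=
    ⟨fun _ h => relations_X.col 0 h,
      fun _ _ _ _ h => absurd h (by simp [Subsingleton.elim _ (0 : Fin 1)])⟩
  have hx' : Algebra.adjoin A (Set.range fun i => X A q k 1 i 0) = ⊤ := by
    rw [← adjoin_X]
    congr 1
    ext a
    simp
  exact exists_mul_equiv
    (L := lift (fun t _ => exchangeMatrix q (fun i => X A q k 1 i 0) t)
      (relations_exchangeMatrix hx))
    (fun t => by simp) hx' hx relations_X adjoin_X _ (by simp) _ (by simp)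

variable (A q k) in
theorem exists_piTensorProduct_equiv (n : ℕ) :
    ∃ e : PiTensorProduct A (fun _ : Fin n => QMat A q k 1) ≃ₗ[A] QMat A q k n,
      ∀ p, e (PiTensorProduct.tprod A p) =
        ((List.finRange n).map fun j => col j (p j)).prod := by
  induction n with
  | zero =>
    let ε : QMat A q k 0 →ₐ[A] A :=
      lift (fun _ => Fin.elim0) ⟨fun j => j.elim0, fun _ _ j => j.elim0⟩
    let e : A ≃ₐ[A] QMat A q k 0 := AlgEquiv.ofAlgHom (Algebra.ofId A _) ε
      (algHom_ext fun _ j => j.elim0) (Subsingleton.elim _ _)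
    refine ⟨(PiTensorProduct.isEmptyEquiv (Fin 0)).trans e.toLinearEquiv, fun p => ?_⟩
    simp
  | succ n ih =>
    obtain ⟨e, he⟩ := ih
    obtain ⟨σ, hσ⟩ := PiTensorProduct.exists_finSucc_equiv A (QMat A q k 1) n
    obtain ⟨μ, hμ⟩ := exists_col_mul_equiv A q k n
    refine ⟨σ.trans ((TensorProduct.congr (LinearEquiv.refl A _) e).trans μ), fun p => ?_⟩
    simp [hσ, hμ, he, map_list_prod, List.finRange_succ, Function.comp_def, mapCols_succ_col]

end QMat

/-- For each `j` there is a unique `A`-algebra homomorphism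
`c_j : S_q(k,1) → S_q(k,n)` with `c_j(X_{i1}) = X_{ij}`, and the `A`-linear map
`Φ : S_q(k,1)^{⊗ n} → S_q(k,n)` determined by
`Φ(p_1 ⊗ ⋯ ⊗ p_n) = c_1(p_1)⋯c_n(p_n)` is an isomorphism of `A`-modules. -/
theorem QMat.column_embedding_and_tensor_iso
    (A : Type*) [CommRing A] (q : Aˣ) (k n : ℕ) (hk : 1 ≤ k) (hn : 1 ≤ n) :
    (∀ j : Fin n, ∃! c : QMat A q k 1 →ₐ[A] QMat A q k n,
        ∀ i : Fin k, c (QMat.X A q k 1 i 0) = QMat.X A q k n i j) ∧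
    ∀ c : Fin n → (QMat A q k 1 →ₐ[A] QMat A q k n),
      (∀ (j : Fin n) (i : Fin k), c j (QMat.X A q k 1 i 0) = QMat.X A q k n i j) →
      ∃ Φ : PiTensorProduct A (fun _ : Fin n => QMat A q k 1) ≃ₗ[A] QMat A q k n,
        ∀ p : Fin n → QMat A q k 1,
          Φ (PiTensorProduct.tprod A p) =
            ((List.finRange n).map fun j => c j (p j)).prod := by
  refine ⟨fun j => ⟨col j, fun i => col_X i j, fun c hc => algHom_ext_one fun i => ?_⟩,
    fun c hc => ?_⟩
  · rw [hc, col_X]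
  · obtain rfl : c = col := funext fun j => algHom_ext_one fun i => by rw [hc, col_X]
    exact exists_piTensorProduct_equiv A q k n
end

section
/- For all μ₁, μ₂ ∈ ℕ and 0 ≤ i ≤ min(μ₁,μ₂): (a) E_j v_i^{μ₁,μ₂} = 0 for every 1 ≤ j ≤ k−1; (b) conversely, if v lies in the span of those basis vectors X^m whose column sums are (μ₁, μ₂) (∑_a m_{a,1} = μ₁ and ∑_a m_{a,2} = μ₂) and whose row sums are (μ₁+μ₂−i, i, 0, …, 0) (m_{1,1}+m_{1,2} = μ₁+μ₂−i, m_{2,1}+m_{2,2} = i, m_{a,c} = 0 for a ≥ 3), and if E_j v = 0 for all 1 ≤ j ≤ k−1, then v is a scalar multiple of v_i^{μ₁,μ₂}. -/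
/-- The variable `q` in the field `ℚ(q)` of rational functions. -/
noncomputable def qq : RatFunc ℚ := RatFunc.X

/-- The quantum integer `[m] = ∑_{s=0}^{m-1} q^{m-1-2s} = (q^m - q^{-m})/(q - q^{-1})`. -/
noncomputable def qint (m : ℕ) : RatFunc ℚ :=
  ∑ s ∈ Finset.range m, qq ^ ((m : ℤ) - 1 - 2 * (s : ℤ))

/-- The quantum factorial `[m]! = [m][m-1]⋯[1]`. -/
noncomputable def qfact (m : ℕ) : RatFunc ℚ :=
  ∏ r ∈ Finset.range m, qint (r + 1)

/-- The quantum binomial coefficient `[m]!/([a]![m-a]!)`. -/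
noncomputable def qbinom (m a : ℕ) : RatFunc ℚ :=
  qfact m / (qfact a * qfact (m - a))

/-- The `ℚ(q)`-vector space with basis `X^m` indexed by the exponent functions
`m : Fin k × Fin 2 → ℕ` (rows `1,…,k` and two columns, 0-indexed). -/
abbrev Mmod (k : ℕ) := (Fin k × Fin 2 → ℕ) →₀ RatFunc ℚ

/-- The basis vector `X^m` of `Mmod k`. -/
noncomputable def Xb {k : ℕ} (m : Fin k × Fin 2 → ℕ) : Mmod k :=
  Finsupp.single m 1

/-- A linear operator on `Mmod k` defined by its values on the basis `X^m`. -/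
noncomputable def mkOp {k : ℕ} (f : (Fin k × Fin 2 → ℕ) → Mmod k) :
    Mmod k →ₗ[RatFunc ℚ] Mmod k :=
  Finsupp.lift (Mmod k) (RatFunc ℚ) (Fin k × Fin 2 → ℕ) f

/-- The exponent function `m + ε_p − ε_{p'}` (with truncated subtraction; in all
formulas below a term whose exponent function fails to be `ℕ`-valued carries a
vanishing coefficient `[0] = 0`). -/
def shiftExp {k : ℕ} (m : Fin k × Fin 2 → ℕ) (pup pdown : Fin k × Fin 2) :
    Fin k × Fin 2 → ℕ :=
  fun p => m p + (if p = pup then 1 else 0) - (if p = pdown then 1 else 0)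

/-- The highest weight vector
`v_i^{μ₁,μ₂} = ∑_{a=0}^{i} (−1)^a qbinom(i,a) q^{a(μ₂−a+1)} X^{m(a)}`, where
`m(a)_{1,1} = μ₁−i+a`, `m(a)_{2,1} = i−a`, `m(a)_{1,2} = μ₂−a`,
`m(a)_{2,2} = a` and `m(a)` vanishes on rows `≥ 3`. -/
noncomputable def vvec {k : ℕ} (hk : 2 ≤ k) (μ₁ μ₂ i : ℕ) : Mmod k :=
  ∑ a ∈ Finset.range (i + 1),
    ((-1) ^ a * qbinom i a * qq ^ (a * (μ₂ - a + 1))) •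
      Xb (fun p =>
        if p = ((⟨0, by omega⟩ : Fin k), (0 : Fin 2)) then μ₁ - i + a
        else if p = ((⟨1, by omega⟩ : Fin k), (0 : Fin 2)) then i - a
        else if p = ((⟨0, by omega⟩ : Fin k), (1 : Fin 2)) then μ₂ - a
        else if p = ((⟨1, by omega⟩ : Fin k), (1 : Fin 2)) then a
        else 0)

/-- The raising operator `E_i` of `U_q(gl_k)` acting on `Mmod k` (for
`0 ≤ i`, `i + 1 < k`, i.e. `1 ≤ i+1 ≤ k−1` in 1-indexed notation):
`E_i X^m = [m_{i+1,1}] q^{m_{i,2}−m_{i+1,2}} X^{m+ε_{i,1}−ε_{i+1,1}}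
          + [m_{i+1,2}] X^{m+ε_{i,2}−ε_{i+1,2}}`. -/
noncomputable def Egl {k : ℕ} (i : ℕ) (hi : i + 1 < k) :
    Mmod k →ₗ[RatFunc ℚ] Mmod k :=
  mkOp fun m =>
    (qint (m (⟨i + 1, hi⟩, 0)) *
        qq ^ ((m (⟨i, by omega⟩, 1) : ℤ) - (m (⟨i + 1, hi⟩, 1) : ℤ))) •
      Xb (shiftExp m (⟨i, by omega⟩, 0) (⟨i + 1, hi⟩, 0)) +
    qint (m (⟨i + 1, hi⟩, 1)) •
      Xb (shiftExp m (⟨i, by omega⟩, 1) (⟨i + 1, hi⟩, 1))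

theorem qq_ne_zero : qq ≠ 0 := RatFunc.X_ne_zero

theorem qint_zero : qint 0 = 0 := by simp [qint]

theorem qint_ne_zero {m : ℕ} (hm : 0 < m) : qint m ≠ 0 := by
  intro h
  have key : algebraMap (Polynomial ℚ) (RatFunc ℚ)
      (∑ s ∈ Finset.range m, Polynomial.X ^ (2 * (m - 1 - s))) = qq ^ ((m : ℤ) - 1) * qint m := by
    rw [qint, Finset.mul_sum, map_sum]
    refine Finset.sum_congr rfl fun s hs => ?_
    have hs' := Finset.mem_range.mp hs
    rw [map_pow, RatFunc.algebraMap_X, ← zpow_add₀ qq_ne_zero, ← zpow_natCast, qq]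
    congr 1
    omega
  rw [h, mul_zero, map_eq_zero_iff _ (RatFunc.algebraMap_injective ℚ)] at key
  have := congrArg (Polynomial.eval 1) key
  simp [Polynomial.eval_finsetSum] at this
  omega

theorem qfact_succ (m : ℕ) : qfact (m + 1) = qfact m * qint (m + 1) :=
  Finset.prod_range_succ _ _

theorem qfact_ne_zero (m : ℕ) : qfact m ≠ 0 :=
  Finset.prod_ne_zero_iff.mpr fun _ _ => qint_ne_zero (Nat.succ_pos _)

theorem qbinom_zero_right (m : ℕ) : qbinom m 0 = 1 := by
  have h : qfact 0 = 1 := Finset.prod_range_zero _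
  rw [qbinom, h, one_mul, Nat.sub_zero, div_self (qfact_ne_zero m)]

theorem qbinom_succ_mul {m a : ℕ} (h : a < m) :
    qbinom m (a + 1) * qint (a + 1) = qbinom m a * qint (m - a) := by
  obtain ⟨b, rfl⟩ := Nat.exists_eq_add_of_lt h
  have h₁ : a + b + 1 - (a + 1) = b := by omega
  have h₂ : a + b + 1 - a = b + 1 := by omega
  rw [qbinom, qbinom, h₁, h₂, qfact_succ a, qfact_succ b]
  have := qfact_ne_zero a
  have := qfact_ne_zero b
  have := qint_ne_zero (Nat.succ_pos a)
  have := qint_ne_zero (Nat.succ_pos b)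
  field_simp

/-- The exponent function supported on the first two rows, with first column `(x, y)` and second
column `(z, w)`. -/
def twoRowExp {k : ℕ} (hk : 2 ≤ k) (x y z w : ℕ) : Fin k × Fin 2 → ℕ := fun p =>
  if p = ((⟨0, by omega⟩ : Fin k), (0 : Fin 2)) then x
  else if p = ((⟨1, by omega⟩ : Fin k), (0 : Fin 2)) then y
  else if p = ((⟨0, by omega⟩ : Fin k), (1 : Fin 2)) then z
  else if p = ((⟨1, by omega⟩ : Fin k), (1 : Fin 2)) then w
  else 0

section twoRowExp

variable {k : ℕ} (hk : 2 ≤ k) (x y z w : ℕ)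

@[simp] theorem twoRowExp_zero_zero : twoRowExp hk x y z w (⟨0, by omega⟩, 0) = x := by
  simp [twoRowExp]

@[simp] theorem twoRowExp_one_zero : twoRowExp hk x y z w (⟨1, by omega⟩, 0) = y := by
  simp [twoRowExp]

@[simp] theorem twoRowExp_zero_one : twoRowExp hk x y z w (⟨0, by omega⟩, 1) = z := by
  simp [twoRowExp]

@[simp] theorem twoRowExp_one_one : twoRowExp hk x y z w (⟨1, by omega⟩, 1) = w := by
  simp [twoRowExp]

theorem twoRowExp_of_two_le {a : Fin k} (ha : 2 ≤ (a : ℕ)) (c : Fin 2) :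
    twoRowExp hk x y z w (a, c) = 0 := by
  have h₀ : a ≠ ⟨0, by omega⟩ := by simp only [ne_eq, Fin.ext_iff]; omega
  have h₁ : a ≠ ⟨1, by omega⟩ := by simp only [ne_eq, Fin.ext_iff]; omega
  simp [twoRowExp, h₀, h₁]

theorem eq_twoRowExp {m : Fin k × Fin 2 → ℕ}
    (h : ∀ (a : Fin k) (c : Fin 2), 2 ≤ (a : ℕ) → m (a, c) = 0) :
    m = twoRowExp hk (m (⟨0, by omega⟩, 0)) (m (⟨1, by omega⟩, 0))
      (m (⟨0, by omega⟩, 1)) (m (⟨1, by omega⟩, 1)) := by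
  funext ⟨⟨a, ha⟩, c⟩
  match a, ha with
  | 0, _ => fin_cases c <;> simp
  | 1, _ => fin_cases c <;> simp
  | a + 2, ha => rw [h _ _ (by simp), twoRowExp_of_two_le _ _ _ _ _ (by simp)]

theorem sum_column_eq {m : Fin k × Fin 2 → ℕ}
    (h : ∀ (a : Fin k) (c : Fin 2), 2 ≤ (a : ℕ) → m (a, c) = 0) (c : Fin 2) :
    ∑ a : Fin k, m (a, c) = m (⟨0, by omega⟩, c) + m (⟨1, by omega⟩, c) := by
  obtain ⟨l, rfl⟩ := Nat.exists_eq_add_of_le' hk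
  rw [Fin.sum_univ_succ, Fin.sum_univ_succ,
    Finset.sum_eq_zero fun a _ => h a.succ.succ c (by simp), add_zero]
  rfl

theorem shiftExp_twoRowExp_left :
    shiftExp (twoRowExp hk x (y + 1) z w) (⟨0, by omega⟩, 0) (⟨1, by omega⟩, 0) =
      twoRowExp hk (x + 1) y z w := by
  funext p
  simp only [shiftExp, twoRowExp]
  split_ifs <;> simp_all

theorem shiftExp_twoRowExp_right :
    shiftExp (twoRowExp hk x y z (w + 1)) (⟨0, by omega⟩, 1) (⟨1, by omega⟩, 1) =
      twoRowExp hk x y (z + 1) w := by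
  funext p
  simp only [shiftExp, twoRowExp]
  split_ifs <;> simp_all

theorem Egl_Xb (j : ℕ) (hj : j + 1 < k) (m : Fin k × Fin 2 → ℕ) :
    Egl j hj (Xb m) =
      (qint (m (⟨j + 1, hj⟩, 0)) *
        qq ^ ((m (⟨j, by omega⟩, 1) : ℤ) - (m (⟨j + 1, hj⟩, 1) : ℤ))) •
      Xb (shiftExp m (⟨j, by omega⟩, 0) (⟨j + 1, hj⟩, 0)) +
    qint (m (⟨j + 1, hj⟩, 1)) •
      Xb (shiftExp m (⟨j, by omega⟩, 1) (⟨j + 1, hj⟩, 1)) := by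
  rw [Egl, mkOp, Xb, Finsupp.lift_apply, Finsupp.sum_single_index (by simp), one_smul]

theorem Egl_succ_Xb_twoRowExp (j : ℕ) (hj : j + 1 + 1 < k) :
    Egl (j + 1) hj (Xb (twoRowExp hk x y z w)) = 0 := by
  have h (c : Fin 2) : twoRowExp hk x y z w (⟨j + 1 + 1, hj⟩, c) = 0 :=
    twoRowExp_of_two_le _ _ _ _ _ (Nat.le_add_left 2 j) c
  simp [Egl_Xb, h, qint_zero]

theorem Egl_zero_Xb_twoRowExp :
    Egl 0 (by omega) (Xb (twoRowExp hk x y z w)) =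
      (qint y * qq ^ ((z : ℤ) - w)) • Xb (twoRowExp hk (x + 1) (y - 1) z w) +
        qint w • Xb (twoRowExp hk x y (z + 1) (w - 1)) := by
  rw [Egl_Xb]
  simp only [zero_add, twoRowExp_one_zero, twoRowExp_zero_one, twoRowExp_one_one]
  congr 1
  · cases y with
    | zero => simp [qint_zero]
    | succ y => rw [shiftExp_twoRowExp_left, Nat.add_sub_cancel]
  · cases w with
    | zero => simp [qint_zero]
    | succ w => rw [shiftExp_twoRowExp_right, Nat.add_sub_cancel]

end twoRowExp

/-- The exponent function of the `a`-th term of `vvec hk μ₁ μ₂ i`. -/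
abbrev hwExp {k : ℕ} (hk : 2 ≤ k) (μ₁ μ₂ i a : ℕ) : Fin k × Fin 2 → ℕ :=
  twoRowExp hk (μ₁ - i + a) (i - a) (μ₂ - a) a

/-- The coefficient of the `a`-th term of `vvec hk μ₁ μ₂ i`. -/
noncomputable def hwCoeff (μ₂ i a : ℕ) : RatFunc ℚ :=
  (-1) ^ a * qbinom i a * qq ^ (a * (μ₂ - a + 1))

theorem hwCoeff_zero (μ₂ i : ℕ) : hwCoeff μ₂ i 0 = 1 := by
  simp [hwCoeff, qbinom_zero_right]

theorem hwCoeff_rec {μ₂ i a : ℕ} (hi : i ≤ μ₂) (ha : a < i) :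
    hwCoeff μ₂ i a * (qint (i - a) * qq ^ (((μ₂ - a : ℕ) : ℤ) - a)) +
      hwCoeff μ₂ i (a + 1) * qint (a + 1) = 0 := by
  obtain ⟨b, rfl⟩ := Nat.exists_eq_add_of_lt (ha.trans_le hi)
  have h₁ : a + b + 1 - a + 1 = b + 2 := by omega
  have h₂ : a + b + 1 - (a + 1) + 1 = b + 1 := by omega
  have h₃ : a + b + 1 - a = b + 1 := by omega
  have hq : qq ^ (a * (b + 2)) * qq ^ (((b + 1 : ℕ) : ℤ) - a) = qq ^ ((a + 1) * (b + 1)) := by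
    rw [← zpow_natCast, ← zpow_natCast, ← zpow_add₀ qq_ne_zero]
    congr 1
    push_cast
    ring
  rw [hwCoeff, hwCoeff, h₁, h₂, h₃, ← hq]
  linear_combination (-1) ^ (a + 1) * qq ^ (a * (b + 2)) * qq ^ (((b + 1 : ℕ) : ℤ) - a) *
    qbinom_succ_mul ha

section highestWeight

variable {k : ℕ} (hk : 2 ≤ k) (μ₁ μ₂ i : ℕ)

theorem vvec_eq_sum :
    vvec hk μ₁ μ₂ i = ∑ a ∈ Finset.range (i + 1), hwCoeff μ₂ i a • Xb (hwExp hk μ₁ μ₂ i a) :=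
  rfl

theorem Egl_zero_sum_hwExp (hi : i ≤ μ₂) (c : ℕ → RatFunc ℚ) :
    Egl 0 (by omega) (∑ a ∈ Finset.range (i + 1), c a • Xb (hwExp hk μ₁ μ₂ i a)) =
      ∑ a ∈ Finset.range i,
        (c a * (qint (i - a) * qq ^ (((μ₂ - a : ℕ) : ℤ) - a)) + c (a + 1) * qint (a + 1)) •
          Xb (twoRowExp hk (μ₁ - i + a + 1) (i - a - 1) (μ₂ - a) a) := by
  simp only [map_sum, map_smul, Egl_zero_Xb_twoRowExp, smul_add, Finset.sum_add_distrib, add_smul,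
    smul_smul]
  congr 1
  · rw [Finset.sum_range_succ]
    simp [qint_zero]
  · rw [Finset.sum_range_succ']
    simp only [qint_zero, mul_zero, zero_smul, add_zero]
    refine Finset.sum_congr rfl fun a ha => ?_
    have ha' := Finset.mem_range.mp ha
    congr 3
    omega

/-- A combination of the `Xb (hwExp hk μ₁ μ₂ i a)` killed by `E_1` has coefficients proportional
to those of `vvec`. -/
theorem coeff_eq_of_Egl_zero_eq_zero (hi : i ≤ μ₂) (c : ℕ → RatFunc ℚ)
    (h : Egl 0 (by omega) (∑ a ∈ Finset.range (i + 1), c a • Xb (hwExp hk μ₁ μ₂ i a)) = 0)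
    {a : ℕ} (ha : a ≤ i) : c a = c 0 * hwCoeff μ₂ i a := by
  have hrec : ∀ b < i,
      c b * (qint (i - b) * qq ^ (((μ₂ - b : ℕ) : ℤ) - b)) + c (b + 1) * qint (b + 1) = 0 := by
    intro b hb
    rw [Egl_zero_sum_hwExp hk μ₁ μ₂ i hi] at h
    have := DFunLike.congr_fun h (twoRowExp hk (μ₁ - i + b + 1) (i - b - 1) (μ₂ - b) b)
    rw [Finsupp.finsetSum_apply, Finset.sum_eq_single b] at this
    · simpa [Xb] using this
    · intro b' _ hne
      have : twoRowExp hk (μ₁ - i + b' + 1) (i - b' - 1) (μ₂ - b') b' ≠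
          twoRowExp hk (μ₁ - i + b + 1) (i - b - 1) (μ₂ - b) b := fun he =>
        hne (by simpa using congrFun he (⟨1, by omega⟩, 1))
      simp [Xb, this]
    · exact fun hb' => absurd (Finset.mem_range.mpr hb) hb'
  induction a with
  | zero => rw [hwCoeff_zero, mul_one]
  | succ a ih =>
    refine mul_right_cancel₀ (qint_ne_zero (Nat.succ_pos a)) ?_
    have e := hrec a ha
    rw [ih (by omega)] at e
    linear_combination e - c 0 * hwCoeff_rec hi ha

theorem exists_eq_sum_hwExp {v : Mmod k}
    (hv : v ∈ Submodule.span (RatFunc ℚ)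
      ((fun a => (Xb (hwExp hk μ₁ μ₂ i a) : Mmod k)) '' (Finset.range (i + 1) : Set ℕ))) :
    ∃ c : ℕ → RatFunc ℚ, v = ∑ a ∈ Finset.range (i + 1), c a • Xb (hwExp hk μ₁ μ₂ i a) := by
  obtain ⟨c, hc⟩ := (Submodule.mem_span_image_finset_iff_exists_fun _).mp hv
  refine ⟨fun a => if h : a ∈ Finset.range (i + 1) then c ⟨a, h⟩ else 0, ?_⟩
  rw [← hc, ← Finset.sum_coe_sort (Finset.range (i + 1)) fun a => _ • Xb (hwExp hk μ₁ μ₂ i a)]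
  exact Finset.sum_congr rfl fun a _ => by rw [dif_pos a.2]

end highestWeight

/-- (a) The vectors `v_i^{μ₁,μ₂}` are highest weight vectors: `E_j v_i^{μ₁,μ₂} = 0`
for all `j`; (b) conversely, any vector supported on the basis vectors `X^m`
with column sums `(μ₁, μ₂)` and row sums `(μ₁+μ₂−i, i, 0, …, 0)` which is
killed by all `E_j` is a scalar multiple of `v_i^{μ₁,μ₂}`. -/
theorem vvec_highest_weight {k : ℕ} (hk : 2 ≤ k) (μ₁ μ₂ i : ℕ)
    (hi₁ : i ≤ μ₁) (hi₂ : i ≤ μ₂) :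
    (∀ (j : ℕ) (hj : j + 1 < k), Egl j hj (vvec hk μ₁ μ₂ i) = 0) ∧
    (∀ v : Mmod k,
      v ∈ Submodule.span (RatFunc ℚ)
        {x : Mmod k | ∃ m : Fin k × Fin 2 → ℕ,
          x = Xb m ∧
          (∑ a : Fin k, m (a, 0)) = μ₁ ∧
          (∑ a : Fin k, m (a, 1)) = μ₂ ∧
          m ((⟨0, by omega⟩ : Fin k), 0) + m ((⟨0, by omega⟩ : Fin k), 1)
            = μ₁ + μ₂ - i ∧
          m ((⟨1, by omega⟩ : Fin k), 0) + m ((⟨1, by omega⟩ : Fin k), 1) = i ∧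
          ∀ (a : Fin k) (c : Fin 2), 2 ≤ (a : ℕ) → m (a, c) = 0} →
      (∀ (j : ℕ) (hj : j + 1 < k), Egl j hj v = 0) →
      ∃ c : RatFunc ℚ, v = c • vvec hk μ₁ μ₂ i) := by
  constructor
  · rintro (_ | j) hj
    · rw [vvec_eq_sum, Egl_zero_sum_hwExp hk μ₁ μ₂ i hi₂]
      refine Finset.sum_eq_zero fun a ha => ?_
      rw [hwCoeff_rec hi₂ (Finset.mem_range.mp ha), zero_smul]
    · rw [vvec_eq_sum, map_sum]
      refine Finset.sum_eq_zero fun a _ => ?_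
      rw [map_smul, Egl_succ_Xb_twoRowExp, smul_zero]
  · intro v hv hE
    obtain ⟨c, rfl⟩ := exists_eq_sum_hwExp hk μ₁ μ₂ i <| by
      refine Submodule.span_mono ?_ hv
      rintro _ ⟨m, rfl, h₁, h₂, -, h₄, h₅⟩
      rw [sum_column_eq hk h₅] at h₁ h₂
      refine ⟨m (⟨1, by omega⟩, 1), by simp; omega, ?_⟩
      dsimp only
      conv_rhs => rw [eq_twoRowExp hk h₅]
      rw [hwExp]
      congr 2 <;> omega
    refine ⟨c 0, ?_⟩
    rw [vvec_eq_sum, Finset.smul_sum]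
    refine Finset.sum_congr rfl fun a ha => ?_
    rw [smul_smul, ← coeff_eq_of_Egl_zero_eq_zero hk μ₁ μ₂ i hi₂ c (hE 0 (by omega))
      (Finset.mem_range_succ_iff.mp ha)]
end
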